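/- Fix a source schema S and a target schema T. A LAV schema mapping M = (S,T,Σ) is uniquely characterizable by a finite set of positive and negative schema-mapping examples, with respect to the class of all LAV schema mappings over S,T, if and only if M is logically equivalent to a c-acyclic LAV schema mapping. Moreover, if M is c-acyclic, then a uniquely characterizing set of positive and negative schema-mapping examples can be constructed in polynomial time (for fixed S, T). -/

import Mathlib

/-- A finite relational structure over a schema `S` (with arity function `ar`)
with `k` distinguished elements. -/
structure PStruct (S : Type) (ar : S → ℕ) (k : ℕ) : Type 1 where
  dom : Type
  finite : Finite dom
  facts : ∀ R : S, Set (Fin (ar R) → dom)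
  dist : Fin k → dom

attribute [instance] PStruct.finite

namespace PStruct

variable {S : Type} {ar : S → ℕ} {k : ℕ}

/-- `h` is a homomorphism from `A` to `B`: it preserves all facts and maps
distinguished elements to corresponding distinguished elements. -/
def IsHom (A B : PStruct S ar k) (h : A.dom → B.dom) : Prop :=
  (∀ (R : S) (t : Fin (ar R) → A.dom), t ∈ A.facts R → (fun i => h (t i)) ∈ B.facts R) ∧
  ∀ i : Fin k, h (A.dist i) = B.dist i

/-- `(A,𝐚) → (B,𝐛)`: a homomorphism exists. -/
def HomTo (A B : PStruct S ar k) : Prop := ∃ h, IsHom A B h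

/-- Homomorphic equivalence. -/
def HomEquiv (A B : PStruct S ar k) : Prop := HomTo A B ∧ HomTo B A

/-- Direct product of two structures with distinguished elements. -/
def prod (A B : PStruct S ar k) : PStruct S ar k where
  dom := A.dom × B.dom
  finite := inferInstance
  facts R := {t | (fun i => (t i).1) ∈ A.facts R ∧ (fun i => (t i).2) ∈ B.facts R}
  dist i := (A.dist i, B.dist i)

/-- The facts of a structure, as a type. -/
def Fact (A : PStruct S ar k) : Type := Σ R : S, {t : Fin (ar R) → A.dom // t ∈ A.facts R}

/-- Occurrences of elements in facts: a fact together with a position in it. -/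
def Occ (A : PStruct S ar k) : Type :=
  Σ R : S, {t : Fin (ar R) → A.dom // t ∈ A.facts R} × Fin (ar R)

def Occ.fact {A : PStruct S ar k} (o : Occ A) : Fact A := ⟨o.1, o.2.1⟩

def Occ.elem {A : PStruct S ar k} (o : Occ A) : A.dom := o.2.1.1 o.2.2

/-- Vertices of the (subdivided) incidence graph: elements, occurrences, and facts.
Each occurrence vertex subdivides one edge of the bipartite incidence multigraph,
so that cycles (resp. connectivity) of the incidence multigraph correspond exactly to
cycles (resp. connectivity) of this simple graph. -/
def IncV (A : PStruct S ar k) : Type := A.dom ⊕ (Occ A ⊕ Fact A)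

/-- The incidence graph of a structure, as a simple graph (with each
element-occurrence-in-a-fact edge of the incidence multigraph subdivided). -/
def incGraph (A : PStruct S ar k) : SimpleGraph (IncV A) where
  Adj v w := ∃ o : Occ A,
    (v = Sum.inl o.elem ∧ w = Sum.inr (Sum.inl o)) ∨
    (w = Sum.inl o.elem ∧ v = Sum.inr (Sum.inl o)) ∨
    (v = Sum.inr (Sum.inl o) ∧ w = Sum.inr (Sum.inr o.fact)) ∨
    (w = Sum.inr (Sum.inl o) ∧ v = Sum.inr (Sum.inr o.fact))
  symm := by
    refine ⟨?_⟩
    rintro v w ⟨o, h⟩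
    exact ⟨o, by tauto⟩
  loopless := by
    refine ⟨?_⟩
    rintro v ⟨o, (⟨h1, h2⟩ | ⟨h1, h2⟩ | ⟨h1, h2⟩ | ⟨h1, h2⟩)⟩ <;> rw [h1] at h2 <;>
      first
      | exact Sum.inl_ne_inr h2
      | exact Sum.inl_ne_inr (Sum.inr.inj h2)

/-- A structure is acyclic if its incidence graph is acyclic (Berge acyclicity). -/
def Acyclic (A : PStruct S ar k) : Prop := (incGraph A).IsAcyclic

/-- A structure is c-acyclic if every cycle of its incidence graph passes through
a distinguished element. -/
def CAcyclic (A : PStruct S ar k) : Prop :=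
  ∀ (v : IncV A) (c : (incGraph A).Walk v v), c.IsCycle →
    ∃ i : Fin k, Sum.inl (A.dist i) ∈ c.support

/-- A structure is c-connected if every connected component of its incidence graph
contains a distinguished element. -/
def CConnected (A : PStruct S ar k) : Prop :=
  ∀ v : IncV A, ∃ i : Fin k, (incGraph A).Reachable (Sum.inl (A.dist i)) v

/-- The incidence graph is connected. -/
def IncConnected (A : PStruct S ar k) : Prop := (incGraph A).Connected

/-- The fact graph: vertices are facts, with an edge between distinct facts that
share a non-distinguished element. -/
def factGraph (A : PStruct S ar k) : SimpleGraph (Fact A) where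
  Adj f g := f ≠ g ∧ ∃ b : A.dom, (∀ i, b ≠ A.dist i) ∧ (∃ j, f.2.1 j = b) ∧ (∃ j, g.2.1 j = b)
  symm := by
    refine ⟨?_⟩
    rintro f g ⟨hne, b, h1, h2, h3⟩
    exact ⟨hne.symm, b, h1, h3, h2⟩
  loopless := by refine ⟨?_⟩; rintro f ⟨hne, -⟩; exact hne rfl

/-- A structure is fg-connected if its fact graph is connected. -/
def FgConnected (A : PStruct S ar k) : Prop := (factGraph A).Connected

/-- A structure is a core if it admits no homomorphism to a proper substructure,
i.e. every endomorphism is surjective on elements and on facts. -/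
def IsCore (A : PStruct S ar k) : Prop :=
  ∀ h : A.dom → A.dom, IsHom A A h →
    Function.Surjective h ∧
    ∀ (R : S) (t : Fin (ar R) → A.dom), t ∈ A.facts R →
      ∃ s ∈ A.facts R, (fun i => h (s i)) = t

/-- Unique Names Property: the distinguished elements are pairwise distinct. -/
def UNP (A : PStruct S ar k) : Prop := Function.Injective A.dist

/-- A structure is safe if every distinguished element occurs in at least one fact. -/
def Safe (A : PStruct S ar k) : Prop :=
  ∀ i : Fin k, ∃ (R : S) (t : Fin (ar R) → A.dom), t ∈ A.facts R ∧ ∃ j, t j = A.dist i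

/-- A structure is (the canonical structure of) a conjunctive query iff every element
occurs in at least one fact (in particular it is safe). -/
def IsCQ (A : PStruct S ar k) : Prop :=
  ∀ x : A.dom, ∃ (R : S) (t : Fin (ar R) → A.dom), t ∈ A.facts R ∧ ∃ j, t j = x

/-- The size of a structure: its number of facts. -/
noncomputable def size (A : PStruct S ar k) : ℕ := Nat.card (Fact A)

/-- The total size of a set of structures: the sum of (size + 1) over its members. -/
noncomputable def totalSize (F : Set (PStruct S ar k)) : ℕ := ∑ᶠ B ∈ F, (size B + 1)

/-- `F` is a frontier for `A` with respect to the class `C`. -/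
def IsFrontier (C : Set (PStruct S ar k)) (A : PStruct S ar k)
    (F : Set (PStruct S ar k)) : Prop :=
  F.Finite ∧
  (∀ B ∈ F, HomTo B A) ∧
  (∀ B ∈ F, ¬ HomTo A B) ∧
  ∀ C' ∈ C, HomTo C' A → ¬ HomTo A C' → ∃ B ∈ F, HomTo C' B

/-- `D` is a finite duality for `A` with respect to the class `C`. -/
def IsDuality (C : Set (PStruct S ar k)) (A : PStruct S ar k)
    (D : Set (PStruct S ar k)) : Prop :=
  D.Finite ∧ ∀ C' ∈ C, (HomTo A C' ↔ ∀ B ∈ D, ¬ HomTo C' B)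

/-- A conjunctive query (given by its canonical structure `Q`) fits the example sets
`(E⁺, E⁻)`: every example in `E⁺` is positive and every example in `E⁻` is negative.
(By Chandra–Merlin, `(A,𝐚)` is a positive example for `Q` iff `Q → (A,𝐚)`.) -/
def Fits (Q : PStruct S ar k) (Ep Em : Set (PStruct S ar k)) : Prop :=
  (∀ E ∈ Ep, HomTo Q E) ∧ (∀ E ∈ Em, ¬ HomTo Q E)

/-- `(E⁺, E⁻)` uniquely characterizes the CQ `Q` with respect to the class `C` of CQs
(all represented by their canonical structures): `Q` fits, and every member of `C`
that fits is logically equivalent (i.e. homomorphically equivalent) to `Q`. -/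
def UniquelyCharacterizes (Ep Em : Set (PStruct S ar k)) (Q : PStruct S ar k)
    (C : Set (PStruct S ar k)) : Prop :=
  Fits Q Ep Em ∧ ∀ Q' ∈ C, Fits Q' Ep Em → HomEquiv Q Q'

end PStruct

open PStruct

/-- A LAV constraint `∀𝐱 (α(𝐱) → ∃𝐲 φ(𝐱,𝐲))`: the source atom `α` is given by a source
relation `rel` together with a surjective assignment `pat` of its positions to the
variables `𝐱` (identified with `Fin m`); the right-hand side `∃𝐲 φ(𝐱,𝐲)` is a
(not necessarily safe) CQ over the target schema with `m` free variables, represented by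
its canonical structure `rhs` (a structure with `m` distinguished elements). -/
structure LavConstraint (S T : Type) (arS : S → ℕ) (arT : T → ℕ) : Type 1 where
  m : ℕ
  rel : S
  pat : Fin (arS rel) → Fin m
  surj : Function.Surjective pat
  rhs : PStruct T arT m

/-- A schema-mapping example `(I,J)`, viewed as a single finite structure over the
disjoint union schema `S ∪ T`, with no distinguished elements. -/
abbrev SMExample (S T : Type) (arS : S → ℕ) (arT : T → ℕ) : Type 1 :=
  PStruct (S ⊕ T) (Sum.elim arS arT) 0

/-- The schema-mapping example `e` satisfies the LAV constraint `c`. -/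
def SatC {S T : Type} {arS : S → ℕ} {arT : T → ℕ}
    (e : SMExample S T arS arT) (c : LavConstraint S T arS arT) : Prop :=
  ∀ t ∈ e.facts (Sum.inl c.rel), ∀ g : Fin c.m → e.dom, (∀ i, t i = g (c.pat i)) →
    ∃ h : c.rhs.dom → e.dom,
      (∀ (Rt : T) (u : Fin (arT Rt) → c.rhs.dom), u ∈ c.rhs.facts Rt →
        (fun i => h (u i)) ∈ e.facts (Sum.inr Rt)) ∧
      ∀ j, h (c.rhs.dist j) = g j

/-- `e` is a positive example for the LAV schema mapping given by the constraint set `M`. -/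
def Sat {S T : Type} {arS : S → ℕ} {arT : T → ℕ}
    (e : SMExample S T arS arT) (M : Set (LavConstraint S T arS arT)) : Prop :=
  ∀ c ∈ M, SatC e c

/-- Logical equivalence of LAV schema mappings. -/
def LogEquiv {S T : Type} {arS : S → ℕ} {arT : T → ℕ}
    (M M' : Set (LavConstraint S T arS arT)) : Prop :=
  ∀ e : SMExample S T arS arT, Sat e M ↔ Sat e M'

/-- `(E⁺,E⁻)` uniquely characterizes the LAV schema mapping `M` w.r.t. the class of all
LAV schema mappings over `S,T`: `M` fits the examples, and every LAV schema mapping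
fitting them is logically equivalent to `M`. -/
def UniqCharMap {S T : Type} {arS : S → ℕ} {arT : T → ℕ}
    (Ep Em : Set (SMExample S T arS arT)) (M : Set (LavConstraint S T arS arT)) : Prop :=
  (∀ e ∈ Ep, Sat e M) ∧ (∀ e ∈ Em, ¬ Sat e M) ∧
  ∀ M' : Set (LavConstraint S T arS arT), M'.Finite →
    (∀ e ∈ Ep, Sat e M') → (∀ e ∈ Em, ¬ Sat e M') → LogEquiv M M'

/-- A LAV schema mapping is c-acyclic if the right-hand side of each of its constraints
is a c-acyclic (not necessarily safe) CQ. -/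
def CAcyclicMap {S T : Type} {arS : S → ℕ} {arT : T → ℕ}
    (M : Set (LavConstraint S T arS arT)) : Prop :=
  ∀ c ∈ M, CAcyclic c.rhs

/-- The size of a LAV schema mapping. -/
noncomputable def mapSize {S T : Type} {arS : S → ℕ} {arT : T → ℕ}
    (M : Set (LavConstraint S T arS arT)) : ℕ :=
  ∑ᶠ c ∈ M, (size c.rhs + c.m + 1)

/-! ### Generic combinatorics of edge systems -/

/-- `Y` has a leaf edge: an edge with at most one vertex shared with the others. -/
def LeafOn {E X : Type*} (mem : E → X → Prop) (Y : Finset E) : Prop :=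
  ∃ f ∈ Y, ∀ x y, mem f x → mem f y → (∃ f' ∈ Y, f' ≠ f ∧ mem f' x) →
    (∃ f' ∈ Y, f' ≠ f ∧ mem f' y) → x = y

/-- All nonempty sets of at most `g` edges have a leaf. -/
def SparseG {E X : Type*} (mem : E → X → Prop) (g : ℕ) : Prop :=
  ∀ Y : Finset E, Y.Nonempty → Y.card ≤ g → LeafOn mem Y

lemma SparseG.transfer {E X E' X' : Type*} {mem : E → X → Prop} {mem' : E' → X' → Prop} {g : ℕ}
    (h : SparseG mem' g) (φ : E → E') (hφ : Function.Injective φ) (ρ : X → X' → Prop)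
    (h1 : ∀ e x, mem e x → ∃ x', ρ x x' ∧ mem' (φ e) x')
    (h2 : ∀ x x' y', ρ x x' → ρ x y' → x' = y')
    (h3 : ∀ x y x', ρ x x' → ρ y x' → x = y) : SparseG mem g := by
  classical
  intro Y hY hc
  obtain ⟨f', hf', hl⟩ := h (Y.image φ) (hY.image φ) (Finset.card_image_le.trans hc)
  obtain ⟨f, hf, rfl⟩ := Finset.mem_image.1 hf'
  refine ⟨f, hf, ?_⟩
  rintro x y hx hy ⟨a, ha, haf, hax⟩ ⟨b, hb, hbf, hby⟩
  obtain ⟨x', hx', hmx⟩ := h1 _ _ hx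
  obtain ⟨y', hy', hmy⟩ := h1 _ _ hy
  obtain ⟨x2, hx2, hmx2⟩ := h1 _ _ hax
  obtain ⟨y2, hy2, hmy2⟩ := h1 _ _ hby
  obtain rfl := h2 _ _ _ hx' hx2
  obtain rfl := h2 _ _ _ hy' hy2
  have := hl x' y' hmx hmy ⟨φ a, Finset.mem_image_of_mem _ ha, hφ.ne haf, hmx2⟩
    ⟨φ b, Finset.mem_image_of_mem _ hb, hφ.ne hbf, hmy2⟩
  subst this
  exact h3 _ _ _ hx' hy'

/-- Sparseness can be checked componentwise. -/
lemma SparseG.of_comp {E X I : Type*} {mem : E → X → Prop} {g : ℕ} (lab : X → I)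
    (hlab : ∀ e x y, mem e x → mem e y → lab x = lab y)
    (h : ∀ i, SparseG (fun (e : {e : E // ∃ x, mem e x ∧ lab x = i}) x => mem e.1 x) g) :
    SparseG mem g := by
  classical
  intro Y hY hc
  by_cases hne : ∃ f ∈ Y, ∃ x, mem f x
  · obtain ⟨f, hf, x, hx⟩ := hne
    obtain ⟨f1, hf1, hl⟩ := h (lab x) (Y.subtype _) ⟨⟨f, x, hx, rfl⟩, by simpa using hf⟩
      ((Finset.card_subtype _ _).trans_le ((Finset.card_filter_le _ _).trans hc))
    obtain ⟨f1, z, hz, hzl⟩ := f1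
    simp only [Finset.mem_subtype] at hf1
    refine ⟨f1, hf1, ?_⟩
    rintro u v hu hv ⟨a, ha, haf, hax⟩ ⟨b, hb, hbf, hby⟩
    refine hl u v hu hv ⟨⟨a, u, hax, ?_⟩, by simpa using ha, by simpa using haf, hax⟩
      ⟨⟨b, v, hby, ?_⟩, by simpa using hb, by simpa using hbf, hby⟩
    · rw [← hzl]; exact hlab _ _ _ hu hz
    · rw [← hzl]; exact hlab _ _ _ hv hz
  · obtain ⟨f, hf⟩ := hY
    refine ⟨f, hf, fun x y hx => ?_⟩
    exact absurd ⟨f, hf, x, hx⟩ hne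

/-- Strong leaf: a leaf avoiding a given special vertex, for hereditarily leafy sets. -/
lemma strong_leaf {E X : Type*} (mem : E → X → Prop) :
    ∀ (n : ℕ) (Y : Finset E), Y.card = n → Y.Nonempty →
      (∀ Z ⊆ Y, Z.Nonempty → LeafOn mem Z) → ∀ v : X → Prop, (∀ a b, v a → v b → a = b) →
      ∃ f ∈ Y, ∀ x y, mem f x → mem f y → ((∃ f' ∈ Y, f' ≠ f ∧ mem f' x) ∨ v x) →
        ((∃ f' ∈ Y, f' ≠ f ∧ mem f' y) ∨ v y) → x = y := by
  classical
  intro n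
  induction n with
  | zero => intro Y h hne; simp_all
  | succ n ih =>
    intro Y hn hne hleaf v hv
    obtain ⟨f, hf, hl⟩ := hleaf Y subset_rfl hne
    by_cases hok : ∀ x y, mem f x → mem f y → ((∃ f' ∈ Y, f' ≠ f ∧ mem f' x) ∨ v x) →
        ((∃ f' ∈ Y, f' ≠ f ∧ mem f' y) ∨ v y) → x = y
    · exact ⟨f, hf, hok⟩
    -- `f` contains a shared vertex `s` and the special vertex `w`, not shared
    have key : ∃ s w, mem f s ∧ mem f w ∧ (∃ f' ∈ Y, f' ≠ f ∧ mem f' s) ∧ v w ∧ s ≠ w ∧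
        ¬ ∃ f' ∈ Y, f' ≠ f ∧ mem f' w := by
      push Not at hok
      obtain ⟨x, y, hx, hy, h1, h2, hxy⟩ := hok
      rcases h1 with h1 | h1 <;> rcases h2 with h2 | h2
      · exact absurd (hl _ _ hx hy h1 h2) hxy
      · exact ⟨x, y, hx, hy, h1, h2, hxy, fun h => hxy (hl _ _ hx hy h1 h)⟩
      · exact ⟨y, x, hy, hx, h2, h1, hxy.symm, fun h => hxy (hl _ _ hx hy h h2)⟩
      · exact absurd (hv _ _ h1 h2) hxy
    obtain ⟨s, w, hs, hw, ⟨f1, hf1, hf1f, hf1s⟩, hvw, hsw, hwn⟩ := key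
    obtain ⟨f2, hf2, hl2⟩ := ih (Y.erase f) (by rw [Finset.card_erase_of_mem hf, hn]; rfl)
      ⟨f1, by simp [hf1, hf1f]⟩
      (fun Z hZ => hleaf Z (hZ.trans (Finset.erase_subset _ _))) (fun a => a = s)
      (fun a b ha hb => ha.trans hb.symm)
    rw [Finset.mem_erase] at hf2
    refine ⟨f2, hf2.2, ?_⟩
    have conv : ∀ x, mem f2 x → ((∃ f' ∈ Y, f' ≠ f2 ∧ mem f' x) ∨ v x) →
        ((∃ f' ∈ Y.erase f, f' ≠ f2 ∧ mem f' x) ∨ x = s) := by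
      rintro x hx (⟨a, ha, haf, hax⟩ | hvx)
      · by_cases haf' : a = f
        · subst haf'
          exact Or.inr (hl _ _ hax hs ⟨f2, hf2.2, hf2.1, hx⟩ ⟨f1, hf1, hf1f, hf1s⟩)
        · exact Or.inl ⟨a, by simp [ha, haf'], haf, hax⟩
      · obtain rfl := hv _ _ hvx hvw
        exact absurd ⟨f2, hf2.2, hf2.1, hx⟩ hwn
    intro x y hx hy h1 h2
    exact hl2 x y hx hy (conv x hx h1) (conv y hy h2)

/-- A rooted-forest certificate for the edge set `Y`. -/
structure Cert {E X : Type*} (mem : E → X → Prop) (Y : Finset E) where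
  par : X → E
  r : E → E
  rk : E → ℕ
  c1 : ∀ f ∈ Y, ∀ b, mem f b → par b ∈ Y ∧ mem (par b) b
  c2 : ∀ f ∈ Y, ∀ b, mem f b → par b ≠ f → rk (par b) < rk f
  c3 : ∀ f ∈ Y, ∀ b b', mem f b → mem f b' → par b ≠ f → par b' ≠ f → b = b'
  c4 : ∀ f ∈ Y, ∀ b, mem f b → r (par b) = r f
  c5 : ∀ f ∈ Y, r f = f → ∀ b, mem f b → par b = f
  c6 : ∀ f ∈ Y, r f ∈ Y ∧ r (r f) = r f
  c7 : ∀ f ∈ Y, r f ≠ f → ∃ b, mem f b ∧ par b ≠ f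

lemma exists_cert {E X : Type*} [hE : Nonempty E] (mem : E → X → Prop) :
    ∀ (n : ℕ) (Y : Finset E), Y.card = n → (∀ Z ⊆ Y, Z.Nonempty → LeafOn mem Z) →
      Nonempty (Cert mem Y) := by
  classical
  intro n
  induction n with
  | zero =>
    intro Y h _
    obtain rfl := Finset.card_eq_zero.1 h
    exact ⟨⟨fun _ => hE.some, id, fun _ => 0, by simp, by simp, by simp, by simp, by simp,
      by simp, by simp⟩⟩
  | succ n ih =>
    intro Y hn hleaf
    have hne : Y.Nonempty := Finset.card_pos.1 (by omega)
    obtain ⟨f, hf, hl⟩ := hleaf Y subset_rfl hne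
    obtain ⟨C⟩ := ih (Y.erase f) (by rw [Finset.card_erase_of_mem hf, hn]; rfl)
      (fun Z hZ => hleaf Z (hZ.trans (Finset.erase_subset _ _)))
    obtain ⟨par, r, rk, c1, c2, c3, c4, c5, c6, c7⟩ := C
    simp only [Finset.mem_erase] at c1 c2 c3 c4 c5 c6 c7
    by_cases hs : ∃ b0, mem f b0 ∧ ∃ f' ∈ Y, f' ≠ f ∧ mem f' b0
    · obtain ⟨b0, hb0, f1, hf1, hf1f, hf1b⟩ := hs
      have hu : ∀ b f', mem f b → f' ∈ Y → f' ≠ f → mem f' b → b = b0 := fun b f' h1 h2 h3 h4 =>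
        hl b b0 h1 hb0 ⟨f', h2, h3, h4⟩ ⟨f1, hf1, hf1f, hf1b⟩
      have p0 := c1 f1 ⟨hf1f, hf1⟩ b0 hf1b
      refine ⟨⟨fun b => if mem f b ∧ b ≠ b0 then f else par b,
        fun e => if e = f then r (par b0) else r e,
        fun e => if e = f then rk (par b0) + 1 else rk e, ?_, ?_, ?_, ?_, ?_, ?_, ?_⟩⟩
      · intro e he b hb; grind
      · intro e he b hb; grind
      · intro e he b b' hb hb'; grind
      · intro e he b hb; grind
      · intro e he hr b hb; grind
      · intro e he; grind
      · intro e he hr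
        by_cases hef : e = f
        · subst hef; exact ⟨b0, hb0, by grind⟩
        · obtain ⟨b, hb, hp⟩ := c7 e ⟨hef, he⟩ (by grind)
          exact ⟨b, hb, by grind⟩
    · push Not at hs
      refine ⟨⟨fun b => if mem f b then f else par b,
        fun e => if e = f then f else r e,
        fun e => if e = f then 0 else rk e, ?_, ?_, ?_, ?_, ?_, ?_, ?_⟩⟩
      · intro e he b hb; grind
      · intro e he b hb; grind
      · intro e he b b' hb hb'; grind
      · intro e he b hb; grind
      · intro e he hr b hb; grind
      · intro e he; grind
      · intro e he hr
        by_cases hef : e = f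
        · subst hef; grind
        · obtain ⟨b, hb, hp⟩ := c7 e ⟨hef, he⟩ (by grind)
          exact ⟨b, hb, by grind⟩

/-- In an acyclic graph every finite nonempty vertex set has a vertex of degree at most one. -/
lemma acyclic_leaf {V : Type*} (G : SimpleGraph V) (hG : G.IsAcyclic) (W : Set V) (hW : W.Finite)
    (hne : W.Nonempty) : ∃ v ∈ W, ∀ x ∈ W, ∀ y ∈ W, G.Adj v x → G.Adj v y → x = y := by
  classical
  obtain ⟨u, hu⟩ := hne
  have hI : (G.induce W).IsAcyclic := hG.induce W
  have : Finite W := hW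
  have : Finite {v : W // (G.induce W).Reachable ⟨u, hu⟩ v} := inferInstance
  have : Nonempty {v : W // (G.induce W).Reachable ⟨u, hu⟩ v} := ⟨⟨⟨u, hu⟩, .refl _⟩⟩
  obtain ⟨⟨v, hv⟩, hmax⟩ := Finite.exists_max
    (fun v : {v : W // (G.induce W).Reachable ⟨u, hu⟩ v} => (G.induce W).dist ⟨u, hu⟩ v.1)
  obtain ⟨p, hp⟩ := hv.exists_isPath
  have key : ∀ x : W, (G.induce W).Adj v x → x = p.penultimate := by
    intro x hx
    apply hI.eq_penultimate_of_adj_end hp hx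
    by_contra hns
    have hq : (p.concat hx).IsPath := by
      exact hp.concat hns hx
    have hxr : (G.induce W).Reachable ⟨u, hu⟩ x := hv.trans hx.reachable
    have h1 := hmax ⟨x, hxr⟩
    obtain ⟨q, hq1, hq2⟩ := hxr.exists_path_of_dist
    obtain ⟨q', hq1', hq2'⟩ := hv.exists_path_of_dist
    have e1 := congrArg Subtype.val (hI.path_unique ⟨q, hq1⟩ ⟨_, hq⟩)
    have e2 := congrArg Subtype.val (hI.path_unique ⟨q', hq1'⟩ ⟨_, hp⟩)
    simp only at e1 e2 h1
    rw [← hq2, ← hq2', e1, e2] at h1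
    simp at h1
  refine ⟨v.1, v.2, fun x hx y hy hax hay => ?_⟩
  have h1 := key ⟨x, hx⟩ hax
  have h2 := key ⟨y, hy⟩ hay
  exact congrArg Subtype.val (h1.trans h2.symm)

/-! ### c-acyclicity versus the leaf property -/

section P2
variable {S : Type} {ar : S → ℕ} {k : ℕ}

/-- `x` is a non-distinguished element of the fact `f`. -/
def nmem (A : PStruct S ar k) (f : Fact A) (x : A.dom) : Prop :=
  (∃ j, f.2.1 j = x) ∧ ∀ i, A.dist i ≠ x

def NonRep (A : PStruct S ar k) : Prop :=
  ∀ (f : Fact A) (j j' : Fin (ar f.1)), (∀ i, A.dist i ≠ f.2.1 j) → f.2.1 j = f.2.1 j' → j = j'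

def GS (A : PStruct S ar k) (g : ℕ) : Prop := NonRep A ∧ SparseG (nmem A) g

instance finite_Fact [Finite S] (A : PStruct S ar k) : Finite (Fact A) := by
  unfold PStruct.Fact; infer_instance

instance finite_Occ [Finite S] (A : PStruct S ar k) : Finite (Occ A) := by
  unfold Occ; infer_instance

instance finite_IncV [Finite S] (A : PStruct S ar k) : Finite (IncV A) := by
  unfold IncV; infer_instance

lemma PStruct.Occ.ext' {A : PStruct S ar k} (hA : NonRep A) {o o' : Occ A} (h1 : o.fact = o'.fact)
    (h2 : o.elem = o'.elem) (hd : ∀ i, A.dist i ≠ o.elem) : o = o' := by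
  obtain ⟨R, t, j⟩ := o
  obtain ⟨R', t', j'⟩ := o'
  simp only [Occ.fact] at h1
  obtain ⟨rfl, h1⟩ := Sigma.mk.inj h1
  obtain rfl := eq_of_heq h1
  simp only [Occ.elem] at h2 hd
  have := hA ⟨R, t⟩ j j' hd h2
  subst this; rfl

lemma adj_elem {A : PStruct S ar k} {x : A.dom} {w : IncV A} :
    (incGraph A).Adj (Sum.inl x) w ↔ ∃ o : Occ A, o.elem = x ∧ w = Sum.inr (Sum.inl o) := by
  constructor
  · rintro ⟨o, h | h | h | h⟩
    · exact ⟨o, (Sum.inl.inj h.1).symm, h.2⟩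
    · exact absurd h.2 Sum.inl_ne_inr
    · exact absurd h.1 Sum.inl_ne_inr
    · exact absurd h.2 Sum.inl_ne_inr
  · rintro ⟨o, rfl, rfl⟩; exact ⟨o, Or.inl ⟨rfl, rfl⟩⟩

lemma adj_fact {A : PStruct S ar k} {f : Fact A} {w : IncV A} :
    (incGraph A).Adj (Sum.inr (Sum.inr f)) w ↔ ∃ o : Occ A, o.fact = f ∧ w = Sum.inr (Sum.inl o) := by
  constructor
  · rintro ⟨o, h | h | h | h⟩
    · exact absurd h.1.symm Sum.inl_ne_inr
    · exact absurd (Sum.inr.inj h.2).symm Sum.inl_ne_inr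
    · exact absurd (Sum.inr.inj h.1).symm Sum.inl_ne_inr
    · exact ⟨o, (Sum.inr.inj (Sum.inr.inj h.2)).symm, h.1⟩
  · rintro ⟨o, rfl, rfl⟩; exact ⟨o, Or.inr (Or.inr (Or.inr ⟨rfl, rfl⟩))⟩

lemma adj_occ {A : PStruct S ar k} {o : Occ A} {w : IncV A} :
    (incGraph A).Adj (Sum.inr (Sum.inl o)) w ↔
      w = Sum.inl o.elem ∨ w = Sum.inr (Sum.inr o.fact) := by
  constructor
  · rintro ⟨o', h | h | h | h⟩
    · exact absurd h.1.symm Sum.inl_ne_inr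
    · obtain rfl := Sum.inl.inj (Sum.inr.inj h.2); exact Or.inl h.1
    · obtain rfl := Sum.inl.inj (Sum.inr.inj h.1); exact Or.inr h.2
    · exact absurd (Sum.inr.inj h.2) Sum.inl_ne_inr
  · rintro (rfl | rfl)
    · exact ⟨o, Or.inr (Or.inl ⟨rfl, rfl⟩)⟩
    · exact ⟨o, Or.inr (Or.inr (Or.inl ⟨rfl, rfl⟩))⟩

lemma leaf_of_cacyclic [Finite S] {A : PStruct S ar k} (hA : CAcyclic A) (W : Set (IncV A))
    (hne : W.Nonempty) (hd : ∀ i, (Sum.inl (A.dist i) : IncV A) ∉ W) :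
    ∃ v ∈ W, ∀ x ∈ W, ∀ y ∈ W, (incGraph A).Adj v x → (incGraph A).Adj v y → x = y := by
  have hac : ((incGraph A).induce W).IsAcyclic := by
    intro v c hc
    have := hA _ (c.map (SimpleGraph.Embedding.induce W).toHom)
      (hc.map (SimpleGraph.Embedding.induce (G := incGraph A) W).injective)
    obtain ⟨i, hi⟩ := this
    rw [SimpleGraph.Walk.support_map] at hi
    obtain ⟨a, _, ha⟩ := List.mem_map.1 hi
    apply hd i
    rw [← ha]
    exact a.2
  obtain ⟨w, hw⟩ := hne
  obtain ⟨v, _, h⟩ := acyclic_leaf _ hac Set.univ (Set.toFinite _) ⟨⟨w, hw⟩, trivial⟩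
  exact ⟨v.1, v.2, fun x hx y hy h1 h2 =>
    congrArg Subtype.val (h ⟨x, hx⟩ trivial ⟨y, hy⟩ trivial h1 h2)⟩

lemma PStruct.CAcyclic.nonRep [Finite S] {A : PStruct S ar k} (hA : CAcyclic A) : NonRep A := by
  intro f j j' hd hjj
  by_contra hne
  let o : Occ A := ⟨f.1, f.2, j⟩
  let o' : Occ A := ⟨f.1, f.2, j'⟩
  have hoo : o ≠ o' := by
    intro h
    apply hne
    exact (Prod.mk.inj (eq_of_heq (Sigma.mk.inj h).2)).2
  have he : o'.elem = o.elem := hjj.symm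
  let W : Set (IncV A) := {Sum.inl o.elem, Sum.inr (Sum.inl o), Sum.inr (Sum.inl o'),
    Sum.inr (Sum.inr f)}
  obtain ⟨v, hv, h⟩ := leaf_of_cacyclic hA W ⟨Sum.inl o.elem, Or.inl rfl⟩ (by
    rintro i (h | h | h | h)
    · exact hd i (Sum.inl.inj h)
    · exact Sum.inl_ne_inr h
    · exact Sum.inl_ne_inr h
    · exact Sum.inl_ne_inr h)
  have hW : (Sum.inl o.elem : IncV A) ∈ W ∧ (Sum.inr (Sum.inl o) : IncV A) ∈ W ∧
    (Sum.inr (Sum.inl o') : IncV A) ∈ W ∧ (Sum.inr (Sum.inr f) : IncV A) ∈ W :=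
    ⟨Or.inl rfl, Or.inr (Or.inl rfl), Or.inr (Or.inr (Or.inl rfl)), Or.inr (Or.inr (Or.inr rfl))⟩
  obtain ⟨w1, w2, w3, w4⟩ := hW
  rcases hv with rfl | rfl | rfl | rfl
  · exact hoo (Sum.inl.inj (Sum.inr.inj
      (h _ w2 _ w3 (adj_elem.2 ⟨o, rfl, rfl⟩) (adj_elem.2 ⟨o', he, rfl⟩))))
  · exact Sum.inl_ne_inr (h _ w1 _ w4 (adj_occ.2 (Or.inl rfl)) (adj_occ.2 (Or.inr rfl)))
  · exact Sum.inl_ne_inr (h _ w1 _ w4 (adj_occ.2 (Or.inl (by rw [he]))) (adj_occ.2 (Or.inr rfl)))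
  · exact hoo (Sum.inl.inj (Sum.inr.inj
      (h _ w2 _ w3 (adj_fact.2 ⟨o, rfl, rfl⟩) (adj_fact.2 ⟨o', rfl, rfl⟩))))

lemma PStruct.CAcyclic.leaf [Finite S] {A : PStruct S ar k} (hA : CAcyclic A) (Y : Finset (Fact A))
    (hY : Y.Nonempty) : LeafOn (nmem A) Y := by
  by_contra hno
  unfold LeafOn at hno
  push Not at hno
  let Sh : A.dom → Prop := fun x => ∃ f ∈ Y, ∃ f' ∈ Y, f' ≠ f ∧ nmem A f x ∧ nmem A f' x
  let W : Set (IncV A) := {v | (∃ f ∈ Y, v = Sum.inr (Sum.inr f)) ∨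
    (∃ o : Occ A, o.fact ∈ Y ∧ Sh o.elem ∧ v = Sum.inr (Sum.inl o)) ∨
    ∃ x, Sh x ∧ v = Sum.inl x}
  obtain ⟨f0, hf0⟩ := hY
  obtain ⟨v, hv, h⟩ := leaf_of_cacyclic hA W ⟨Sum.inr (Sum.inr f0), Or.inl ⟨f0, hf0, rfl⟩⟩ (by
    rintro i (⟨f, _, h⟩ | ⟨o, _, _, h⟩ | ⟨x, ⟨f, _, _, _, _, hx, _⟩, h⟩)
    · exact Sum.inl_ne_inr h
    · exact Sum.inl_ne_inr h
    · exact hx.2 i (Sum.inl.inj h))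
  have mk : ∀ f ∈ Y, ∀ x, nmem A f x → Sh x →
      ∃ o : Occ A, o.fact = f ∧ o.elem = x ∧ (Sum.inr (Sum.inl o) : IncV A) ∈ W := by
    rintro f hf x ⟨⟨j, hj⟩, hx⟩ hs
    exact ⟨⟨f.1, f.2, j⟩, rfl, hj, Or.inr (Or.inl ⟨⟨f.1, f.2, j⟩, hf, by
      convert hs; exact hj, rfl⟩)⟩
  rcases hv with ⟨f, hf, rfl⟩ | ⟨o, ho, hs, rfl⟩ | ⟨x, hs, rfl⟩
  · obtain ⟨x, y, hx, hy, ⟨a, ha, haf, hax⟩, ⟨b, hb, hbf, hby⟩, hxy⟩ := hno f hf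
    obtain ⟨o, h1, h2, h3⟩ := mk f hf x hx ⟨f, hf, a, ha, haf, hx, hax⟩
    obtain ⟨o', h1', h2', h3'⟩ := mk f hf y hy ⟨f, hf, b, hb, hbf, hy, hby⟩
    have := h _ h3 _ h3' (adj_fact.2 ⟨o, h1, rfl⟩) (adj_fact.2 ⟨o', h1', rfl⟩)
    obtain rfl := Sum.inl.inj (Sum.inr.inj this)
    exact hxy (h2.symm.trans h2')
  · exact Sum.inl_ne_inr (h _ (Or.inr (Or.inr ⟨_, hs, rfl⟩)) _ (Or.inl ⟨_, ho, rfl⟩)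
      (adj_occ.2 (Or.inl rfl)) (adj_occ.2 (Or.inr rfl)))
  · obtain ⟨f, hf, f', hf', hff, hx, hx'⟩ := id hs
    obtain ⟨o, h1, h2, h3⟩ := mk f hf x hx hs
    obtain ⟨o', h1', h2', h3'⟩ := mk f' hf' x hx' hs
    have := h _ h3 _ h3' (adj_elem.2 ⟨o, h2, rfl⟩) (adj_elem.2 ⟨o', h2', rfl⟩)
    obtain rfl := Sum.inl.inj (Sum.inr.inj this)
    exact hff (h1'.symm.trans h1)

lemma PStruct.CAcyclic.gs [Finite S] {A : PStruct S ar k} (hA : CAcyclic A) (g : ℕ) : GS A g :=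
  ⟨hA.nonRep, fun Y hY _ => hA.leaf Y hY⟩

lemma cacyclic_of_gs [Finite S] {A : PStruct S ar k} (hA : ∀ g, GS A g) : CAcyclic A := by
  classical
  intro v c hc
  by_contra hno
  push Not at hno
  have nr := (hA 0).1
  have two : ∀ w ∈ c.support, ∃ x y, x ≠ y ∧ x ∈ c.support ∧ y ∈ c.support ∧
      (incGraph A).Adj w x ∧ (incGraph A).Adj w y := by
    intro w hw
    obtain ⟨x, y, hxy, h⟩ := Set.ncard_eq_two.1 (hc.ncard_neighborSet_toSubgraph_eq_two hw)
    have hx : x ∈ c.toSubgraph.neighborSet w := by rw [h]; simp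
    have hy : y ∈ c.toSubgraph.neighborSet w := by rw [h]; simp
    rw [SimpleGraph.Subgraph.mem_neighborSet] at hx hy
    exact ⟨x, y, hxy, c.mem_verts_toSubgraph.1 hx.symm.fst_mem,
      c.mem_verts_toSubgraph.1 hy.symm.fst_mem, hx.adj_sub, hy.adj_sub⟩
  have hocc : ∀ o : Occ A, (Sum.inr (Sum.inl o) : IncV A) ∈ c.support →
      (Sum.inl o.elem : IncV A) ∈ c.support ∧ (Sum.inr (Sum.inr o.fact) : IncV A) ∈ c.support := by
    intro o ho
    obtain ⟨x, y, hxy, hx, hy, h1, h2⟩ := two _ ho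
    rw [adj_occ] at h1 h2
    rcases h1 with rfl | rfl <;> rcases h2 with rfl | rfl
    · exact absurd rfl hxy
    · exact ⟨hx, hy⟩
    · exact ⟨hy, hx⟩
    · exact absurd rfl hxy
  have hfact : ∀ f : Fact A, (Sum.inr (Sum.inr f) : IncV A) ∈ c.support →
      ∃ o o' : Occ A, o ≠ o' ∧ o.fact = f ∧ o'.fact = f ∧
        (Sum.inr (Sum.inl o) : IncV A) ∈ c.support ∧ (Sum.inr (Sum.inl o') : IncV A) ∈ c.support := by
    intro f hf
    obtain ⟨x, y, hxy, hx, hy, h1, h2⟩ := two _ hf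
    rw [adj_fact] at h1 h2
    obtain ⟨o, h1, rfl⟩ := h1
    obtain ⟨o', h2, rfl⟩ := h2
    exact ⟨o, o', fun h => hxy (by rw [h]), h1, h2, hx, hy⟩
  have helem : ∀ x : A.dom, (Sum.inl x : IncV A) ∈ c.support → ∀ o : Occ A, o.elem = x →
      ∃ o' : Occ A, o' ≠ o ∧ o'.elem = x ∧ (Sum.inr (Sum.inl o') : IncV A) ∈ c.support := by
    intro x hx o ho
    obtain ⟨y, z, hyz, hy, hz, h1, h2⟩ := two _ hx
    rw [adj_elem] at h1 h2
    obtain ⟨o1, h1, rfl⟩ := h1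
    obtain ⟨o2, h2, rfl⟩ := h2
    by_cases h : o1 = o
    · exact ⟨o2, fun h' => hyz (by rw [h, h']), h2, hz⟩
    · exact ⟨o1, h, h1, hy⟩
  have hnd : ∀ x : A.dom, (Sum.inl x : IncV A) ∈ c.support → ∀ i, A.dist i ≠ x := by
    rintro x hx i rfl; exact hno i hx
  have : Fintype (Fact A) := Fintype.ofFinite _
  let Y : Finset (Fact A) := Finset.univ.filter fun f => (Sum.inr (Sum.inr f) : IncV A) ∈ c.support
  have hY : Y.Nonempty := by
    have hv := c.start_mem_support
    rcases hv' : v with x | o | f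
    · obtain ⟨y, z, _, hy, _, h1, _⟩ := two _ c.start_mem_support
      have h1 := adj_elem.1 (hv' ▸ h1)
      obtain ⟨o1, h1, rfl⟩ := h1
      exact ⟨o1.fact, by simpa [Y] using (hocc _ hy).2⟩
    · exact ⟨o.fact, by simpa [Y] using (hocc o (by rw [← hv']; exact c.start_mem_support)).2⟩
    · exact ⟨f, by simp only [Y, Finset.mem_filter, Finset.mem_univ, true_and]; rw [← hv']; exact c.start_mem_support⟩
  obtain ⟨f, hf, hl⟩ := (hA _).2 Y hY le_rfl
  simp only [Y, Finset.mem_filter, Finset.mem_univ, true_and] at hf hl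
  obtain ⟨o, o', hoo, h1, h2, h3, h4⟩ := hfact f hf
  have sh : ∀ o : Occ A, o.fact = f → (Sum.inr (Sum.inl o) : IncV A) ∈ c.support →
      nmem A f o.elem ∧ ∃ f', (Sum.inr (Sum.inr f') : IncV A) ∈ c.support ∧ f' ≠ f ∧
        nmem A f' o.elem := by
    rintro o rfl ho
    have e := (hocc o ho).1
    refine ⟨⟨⟨o.2.2, rfl⟩, hnd _ e⟩, ?_⟩
    obtain ⟨o1, h1, h2, h3⟩ := helem _ e o rfl
    exact ⟨o1.fact, (hocc o1 h3).2, fun h => h1 (Occ.ext' nr h h2 (by rw [h2]; exact hnd _ e)),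
      ⟨o1.2.2, h2⟩, hnd _ e⟩
  obtain ⟨a1, a2⟩ := sh o h1 h3
  obtain ⟨b1, b2⟩ := sh o' h2 h4
  exact hoo (Occ.ext' nr (h1.trans h2.symm) (hl _ _ a1 b1 a2 b2) a1.2)

/-- Sparseness is inherited by (injective images in) substructures. -/
lemma GS.sub {A B : PStruct S ar k} {g : ℕ} (hB : GS B g) (h : A.dom → B.dom) (hh : IsHom A B h)
    (hi : Function.Injective h) : GS A g := by
  have hd : ∀ x, (∀ i, A.dist i ≠ x) → ∀ i, B.dist i ≠ h x := by
    intro x hx i he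
    rw [← hh.2 i] at he
    exact hx i (hi he)
  refine ⟨?_, ?_⟩
  · intro f j j' h1 h2
    exact hB.1 ⟨f.1, _, hh.1 f.1 f.2.1 f.2.2⟩ j j' (hd _ h1) (congrArg h h2)
  · refine hB.2.transfer (fun f : Fact A => (⟨f.1, _, hh.1 f.1 f.2.1 f.2.2⟩ : Fact B)) ?_
      (fun x y => h x = y) ?_ ?_ ?_
    · rintro ⟨R, t, ht⟩ ⟨R', t', ht'⟩ he
      obtain ⟨rfl, he⟩ := Sigma.mk.inj he
      have he := congrArg Subtype.val (eq_of_heq he)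
      have : t = t' := by
        funext i; exact hi (congrFun he i)
      subst this; rfl
    · rintro f x ⟨⟨j, hj⟩, hx⟩
      exact ⟨h x, rfl, ⟨j, congrArg h hj⟩, hd x hx⟩
    · rintro x _ _ rfl rfl; rfl
    · rintro x y _ h1 h2; exact hi (h1.trans h2.symm)

lemma GS.all [Finite S] {A : PStruct S ar k} {g : ℕ} (hA : GS A g) (hs : size A ≤ g) (g' : ℕ) :
    GS A g' := by
  have : Fintype (Fact A) := Fintype.ofFinite _
  refine ⟨hA.1, fun Y hY _ => hA.2 Y hY ?_⟩
  refine le_trans ?_ hs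
  rw [size, Nat.card_eq_fintype_card]
  exact Finset.card_le_univ Y

end P2

/-! ### Sparse hypergraphs with large chromatic number; the partite construction -/

section P3

def HypP (g : ℕ) : Prop :=
  ∀ (X : Type) [Finite X] (n : ℕ), ∃ (W E : Type) (_ : Finite W) (_ : Finite E) (inc : E → X → W),
    (∀ e, Function.Injective (inc e)) ∧ SparseG (fun e w => ∃ x, inc e x = w) g ∧
    ∀ (K : Type) [Finite K] [Nonempty K], Nat.card K ≤ n → ∀ χ : W → K,
      ∃ e, ∀ x y, χ (inc e x) = χ (inc e y)

def PartS (g : ℕ) (B Φ : Type) (supp : Φ → Set B) (n : ℕ) (S : Finset B) : Prop :=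
  ∃ (V E : Type) (_ : Finite V) (_ : Finite E) (τ : E → Φ) (v : E → B → V) (part : V → B),
    (∀ e b, part (v e b) = b) ∧ SparseG (fun e x => ∃ b ∈ supp (τ e), v e b = x) g ∧
    ∀ (K : Type) [Finite K] [Nonempty K], Nat.card K ≤ n → ∀ χ : V → K,
      ∃ (σ : Φ → E) (k : B → K), ∀ φ, τ (σ φ) = φ ∧ ∀ b ∈ S, χ (v (σ φ) b) = k b

lemma partS_empty (g : ℕ) (B Φ : Type) [Finite B] [Finite Φ] (supp : Φ → Set B) (n : ℕ) :
    PartS g B Φ supp n ∅ := by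
  refine ⟨Φ × B, Φ, inferInstance, inferInstance, id, fun φ b => (φ, b), Prod.snd,
    fun _ _ => rfl, ?_, ?_⟩
  · rintro Y ⟨f, hf⟩ _
    refine ⟨f, hf, ?_⟩
    rintro x y ⟨b, _, rfl⟩ _ ⟨f', _, hne, b', _, hb⟩
    exact absurd (congrArg Prod.fst hb) hne
  · intro K _ hK _ χ
    exact ⟨id, fun _ => Classical.arbitrary K, fun φ => ⟨rfl, by simp⟩⟩

lemma partS_step {g : ℕ} (hH : HypP g) (B Φ : Type) [Finite B] [Finite Φ] (supp : Φ → Set B) (n : ℕ)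
    (S : Finset B) (b0 : B) (hS : PartS (g + 1) B Φ supp n S) (S' : Finset B)
    (hS' : ∀ b, b ∈ S' → b = b0 ∨ b ∈ S) : PartS (g + 1) B Φ supp n S' := by
  classical
  obtain ⟨V, E, fV, fE, τ, v, part, hpart, hsp, hmono⟩ := hS
  obtain ⟨W, EH, fW, fEH, inc, hinj, hspH, hcol⟩ := hH V n
  let v' : EH × E → B → W ⊕ (EH × V) := fun he b =>
    if b = b0 then Sum.inl (inc he.1 (v he.2 b)) else Sum.inr (he.1, v he.2 b)
  have key : ∀ h e b h' e' b', v' (h, e) b = v' (h', e') b' →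
      (b = b0 ∧ b' = b0 ∧ inc h (v e b) = inc h' (v e' b')) ∨ (h = h' ∧ v e b = v e' b') := by
    intro h e b h' e' b' heq
    simp only [v'] at heq
    split_ifs at heq with h1 h2 h2
    · exact Or.inl ⟨h1, h2, Sum.inl.inj heq⟩
    · right
      have := Sum.inr.inj heq
      exact ⟨congrArg Prod.fst this, congrArg Prod.snd this⟩
  have key' : ∀ h e b h' e' b', v' (h, e) b = v' (h', e') b' → h = h' → v e b = v e' b' := by
    intro h e b h' e' b' heq hh
    subst hh
    rcases key _ _ _ _ _ _ heq with ⟨_, _, h3⟩ | ⟨_, h3⟩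
    · exact hinj _ h3
    · exact h3
  refine ⟨W ⊕ (EH × V), EH × E, inferInstance, inferInstance, fun he => τ he.2, v',
    Sum.elim (fun _ => b0) (fun hw => part hw.2), ?_, ?_, ?_⟩
  · rintro ⟨h, e⟩ b
    simp only [v']
    split_ifs with hb
    · simp [hb]
    · simp [hpart]
  · intro Y hY hc
    let Hs := Y.image Prod.fst
    have hHs : Hs.Nonempty := hY.image _
    by_cases hcard : Hs.card ≤ g
    · obtain ⟨h, hh, hleaf⟩ := hspH Hs hHs hcard
      let Z := (Y.filter (fun p => p.1 = h)).image Prod.snd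
      have memZ : ∀ e, e ∈ Z ↔ (h, e) ∈ Y := by
        intro e
        simp only [Z, Finset.mem_image, Finset.mem_filter]
        constructor
        · rintro ⟨⟨a, b⟩, ⟨h1, rfl⟩, rfl⟩; exact h1
        · intro h1; exact ⟨(h, e), ⟨h1, rfl⟩, rfl⟩
      have hZc : Z.card ≤ g + 1 :=
        le_trans Finset.card_image_le (le_trans (Finset.card_filter_le _ _) hc)
      have hZne : Z.Nonempty := by
        obtain ⟨⟨a, e⟩, hp, rfl⟩ := Finset.mem_image.1 hh
        exact ⟨e, (memZ e).2 hp⟩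
      obtain ⟨f, hf, hfl⟩ := strong_leaf _ Z.card Z rfl hZne
        (fun Z' hZ' hne => hsp Z' hne (le_trans (Finset.card_le_card hZ') hZc))
        (fun y => ∃ h' ∈ Hs, h' ≠ h ∧ ∃ x', inc h' x' = inc h y)
        (by
          rintro a b ⟨h1, h1m, h1n, h1x⟩ ⟨h2, h2m, h2n, h2x⟩
          exact hinj h (hleaf _ _ ⟨a, rfl⟩ ⟨b, rfl⟩ ⟨h1, h1m, h1n, h1x⟩ ⟨h2, h2m, h2n, h2x⟩))
      refine ⟨(h, f), (memZ f).1 hf, ?_⟩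
      have lift : ∀ b ∈ supp (τ f), (∃ f' ∈ Y, f' ≠ (h, f) ∧
          ∃ b' ∈ supp (τ f'.2), v' f' b' = v' (h, f) b) →
          (∃ f' ∈ Z, f' ≠ f ∧ ∃ b' ∈ supp (τ f'), v f' b' = v f b) ∨
          (∃ h' ∈ Hs, h' ≠ h ∧ ∃ x', inc h' x' = inc h (v f b)) := by
        rintro b hb ⟨⟨h', e'⟩, hm, hne, b', hb', heq⟩
        by_cases hhh : h' = h
        · left
          have h3 := key' _ _ _ _ _ _ heq hhh
          subst hhh
          exact ⟨e', (memZ e').2 hm, fun h => hne (by rw [h]), b', hb', h3⟩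
        · right
          rcases key _ _ _ _ _ _ heq with ⟨_, _, h3⟩ | ⟨h3, _⟩
          · exact ⟨h', Finset.mem_image.2 ⟨_, hm, rfl⟩, hhh, _, h3⟩
          · exact absurd h3 hhh
      rintro _ _ ⟨b, hb, rfl⟩ ⟨b', hb', rfl⟩ hx hy
      have := hfl _ _ ⟨b, hb, rfl⟩ ⟨b', hb', rfl⟩ (lift b hb hx) (lift b' hb' hy)
      have := congrArg part this
      rw [hpart, hpart] at this
      rw [this]
    · have hle : Hs.card ≤ Y.card := Finset.card_image_le
      have hinjY : Set.InjOn Prod.fst (Y : Set (EH × E)) :=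
        Finset.card_image_iff.1 (by change Hs.card = _; omega)
      obtain ⟨⟨h, f⟩, hf⟩ := hY
      refine ⟨(h, f), hf, ?_⟩
      have only : ∀ b, (∃ f' ∈ Y, f' ≠ (h, f) ∧
          ∃ b' ∈ supp (τ f'.2), v' f' b' = v' (h, f) b) → b = b0 := by
        rintro b ⟨⟨h', e'⟩, hm, hne, b', hb', heq⟩
        rcases key _ _ _ _ _ _ heq with ⟨_, h3, _⟩ | ⟨h3, _⟩
        · exact h3
        · exact absurd (hinjY hm hf h3) hne
      rintro _ _ ⟨b, hb, rfl⟩ ⟨b', hb', rfl⟩ hx hy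
      rw [only b hx, only b' hy]
  · intro K _ hK hn χ
    obtain ⟨h, hh⟩ := hcol K hn (fun w => χ (Sum.inl w))
    have hk0 : ∃ k0, ∀ x, χ (Sum.inl (inc h x)) = k0 := by
      rcases isEmpty_or_nonempty V with hV | ⟨⟨x⟩⟩
      · exact ⟨Classical.arbitrary K, fun x => hV.elim x⟩
      · exact ⟨_, fun y => hh y x⟩
    obtain ⟨k0, hk0⟩ := hk0
    obtain ⟨σ, k, hσ⟩ := hmono K hn (fun w => χ (Sum.inr (h, w)))
    refine ⟨fun φ => (h, σ φ), fun b => if b = b0 then k0 else k b, fun φ => ⟨(hσ φ).1, ?_⟩⟩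
    intro b hb
    simp only [v']
    split_ifs with hbb
    · exact hk0 _
    · exact (hσ φ).2 b ((hS' b hb).resolve_left hbb)

lemma partS_all {g : ℕ} (hH : HypP g) (B Φ : Type) [Fintype B] [Finite Φ] (supp : Φ → Set B) (n : ℕ) :
    PartS (g + 1) B Φ supp n Finset.univ := by
  classical
  have : ∀ S : Finset B, PartS (g + 1) B Φ supp n S := by
    intro S
    induction S using Finset.induction_on with
    | empty => exact partS_empty _ _ _ _ _
    | insert b S hb ih =>
      exact partS_step hH B Φ supp n S b ih _ (fun b hb => by simpa using hb)
  exact this _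

/-- Pigeonhole: a large set coloured with few colours has a large monochromatic subset. -/
lemma mono_embed (X K : Type) [Finite X] [Finite K] [Nonempty K] (n : ℕ) (hK : Nat.card K ≤ n)
    (χ : Fin (n * Nat.card X + 1) → K) :
    ∃ ι : X ↪ Fin (n * Nat.card X + 1), ∀ x y, χ (ι x) = χ (ι y) := by
  classical
  have := Fintype.ofFinite X
  have := Fintype.ofFinite K
  rw [Nat.card_eq_fintype_card] at hK
  have hlt : Fintype.card K * Nat.card X < Fintype.card (Fin (n * Nat.card X + 1)) := by
    rw [Fintype.card_fin]
    exact Nat.lt_succ_of_le (Nat.mul_le_mul_right _ hK)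
  obtain ⟨k, hk⟩ := Fintype.exists_lt_card_fiber_of_mul_lt_card χ hlt
  have hle : Fintype.card X ≤ Fintype.card {x // χ x = k} := by
    rw [Fintype.card_subtype]
    exact (Nat.card_eq_fintype_card (α := X)).symm.le.trans hk.le
  obtain ⟨ι⟩ := Function.Embedding.nonempty_of_card_le hle
  exact ⟨ι.trans (Function.Embedding.subtype _), fun x y => (ι x).2.trans (ι y).2.symm⟩

lemma hypP_all (g : ℕ) : HypP g := by
  induction g with
  | zero =>
    intro X _ n
    refine ⟨Fin (n * Nat.card X + 1), X ↪ Fin (n * Nat.card X + 1), inferInstance, inferInstance,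
      fun e => e, fun e => e.injective, ?_, ?_⟩
    · intro Y hY hc
      exact absurd (Finset.card_pos.2 hY) (by omega)
    · intro K _ _ hK χ
      exact mono_embed X K n hK χ
  | succ g ih =>
    intro X _ n
    obtain ⟨V, E, fV, fE, τ, v, part, hpart, hsp, hmono⟩ :=
      partS_all ih (Fin (n * Nat.card X + 1)) (X ↪ Fin (n * Nat.card X + 1))
        (fun φ => Set.range φ) n
    refine ⟨V, E, fV, fE, fun e x => v e (τ e x), ?_, ?_, ?_⟩
    · intro e x y hxy
      have := congrArg part hxy
      simp only [hpart] at this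
      exact (τ e).injective this
    · have : (fun (e : E) w => ∃ x, v e ((τ e) x) = w) =
        (fun e x => ∃ b ∈ Set.range (τ e), v e b = x) := by
        funext e w
        simp
      rw [this]; exact hsp
    · intro K _ _ hK χ
      obtain ⟨σ, k, hσ⟩ := hmono K hK χ
      obtain ⟨ι, hι⟩ := mono_embed X K n hK k
      refine ⟨σ ι, fun x y => ?_⟩
      simp only [(hσ ι).1, (hσ ι).2 _ (Finset.mem_univ _)]
      exact hι x y

/-- A structure given by a family of facts. -/
def ofFam {T : Type} {ar : T → ℕ} {k : ℕ} (dom : Type) [Finite dom] {E : Type}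
    (F : E → Σ R : T, Fin (ar R) → dom) (dist : Fin k → dom) : PStruct T ar k where
  dom := dom
  finite := inferInstance
  facts R := {t | ∃ e, F e = ⟨R, t⟩}
  dist := dist

lemma exists_arity_bound {T : Type} [Finite T] (ar : T → ℕ) : ∃ r, ∀ R, ar R ≤ r := by
  obtain ⟨r, hr⟩ := (Set.finite_range ar).bddAbove
  exact ⟨r, fun R => hr ⟨R, rfl⟩⟩

/-- Sparse incomparability lemma. -/
lemma sparse_struct {T : Type} [Finite T] {ar : T → ℕ} {k : ℕ} (A : PStruct T ar k) (n g : ℕ) :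
    ∃ C : PStruct T ar k, HomTo C A ∧ GS C g ∧
      ∀ D : PStruct T ar k, Nat.card D.dom ≤ n → HomTo C D → HomTo A D := by
  classical
  obtain ⟨r, hr⟩ := exists_arity_bound ar
  let N := (n + 1) * Nat.card (Fin r) + 1
  let Φ := Σ f : Fact A, {ι : Fin (ar f.1) → Fin N // Function.Injective fun j => (f.2.1 j, ι j)}
  have fΦ : Finite Φ := inferInstance
  have fA : Fintype A.dom := Fintype.ofFinite _
  let nd : A.dom → Prop := fun a => ∀ i, A.dist i ≠ a
  obtain ⟨V, E, fV, fE, τ, v, part, hpart, hsp, hmono⟩ :=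
    partS_all (hypP_all g) (A.dom × Fin N) Φ
      (fun φ => {b | ∃ j, nd (φ.1.2.1 j) ∧ b = (φ.1.2.1 j, φ.2.1 j)}) (n + 1)
  let F : E → Σ R : T, Fin (ar R) → A.dom ⊕ V := fun e =>
    ⟨(τ e).1.1, fun j => if nd ((τ e).1.2.1 j) then Sum.inr (v e ((τ e).1.2.1 j, (τ e).2.1 j))
      else Sum.inl ((τ e).1.2.1 j)⟩
  let C : PStruct T ar k := ofFam (A.dom ⊕ V) F (fun i => Sum.inl (A.dist i))
  have hF : ∀ f : Fact C, ∃ e, F e = ⟨f.1, f.2.1⟩ := fun f => f.2.2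
  have hval : ∀ (f : Fact C) (j : Fin (ar f.1)) (e : E), F e = ⟨f.1, f.2.1⟩ →
      (∀ i, C.dist i ≠ f.2.1 j) → ∃ j' : Fin (ar (τ e).1.1), nd ((τ e).1.2.1 j') ∧ j'.1 = j.1 ∧
        f.2.1 j = Sum.inr (v e ((τ e).1.2.1 j', (τ e).2.1 j')) := by
    rintro ⟨R, t, ht⟩ j e he hj
    obtain ⟨rfl, he⟩ := Sigma.mk.inj he
    have he := eq_of_heq he
    simp only at he hj ⊢
    subst he
    by_cases h : nd ((τ e).1.2.1 j)
    · refine ⟨j, h, rfl, ?_⟩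
      exact if_pos h
    · exfalso
      have h' := h
      simp only [nd] at h
      push Not at h
      obtain ⟨i, hi⟩ := h
      apply hj i
      exact (congrArg Sum.inl hi).trans (if_neg h').symm
  refine ⟨C, ⟨Sum.elim id (fun x => (part x).1), ?_, fun i => rfl⟩, ⟨?_, ?_⟩, ?_⟩
  · rintro R t ⟨e, he⟩
    obtain ⟨rfl, he⟩ := Sigma.mk.inj he
    have he := eq_of_heq he
    subst he
    convert (τ e).1.2.2 using 1
    funext j
    simp only
    split_ifs
    · simp [hpart]
    · simp
  · intro f j j' hj hjj
    obtain ⟨e, he⟩ := hF f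
    obtain ⟨a, _, ha1, ha2⟩ := hval f j e he hj
    obtain ⟨b, _, hb1, hb2⟩ := hval f j' e he (hjj ▸ hj)
    rw [ha2, hb2] at hjj
    have := congrArg part (Sum.inr.inj hjj)
    rw [hpart, hpart] at this
    have := (τ e).2.2 this
    apply Fin.ext
    rw [← ha1, ← hb1, this]
  · choose φ hφ using hF
    have hsp' : SparseG (fun e x => ∃ b ∈ {b : A.dom × Fin N | ∃ j, nd ((τ e).1.2.1 j) ∧
        b = ((τ e).1.2.1 j, (τ e).2.1 j)}, v e b = x) g := fun Y hY hc => hsp Y hY (by omega)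
    refine hsp'.transfer φ ?_ (fun x x' => x = Sum.inr x') ?_ ?_ ?_
    · rintro ⟨R, t, ht⟩ ⟨R', t', ht'⟩ h
      have h1 := (hφ ⟨R', t', ht'⟩).symm.trans ((congrArg F h).symm.trans (hφ ⟨R, t, ht⟩))
      obtain ⟨rfl, h1⟩ := Sigma.mk.inj h1
      obtain rfl := eq_of_heq h1
      rfl
    · rintro f x ⟨⟨j, rfl⟩, hx⟩
      obtain ⟨a, ha0, ha1, ha2⟩ := hval f j _ (hφ f) hx
      exact ⟨_, ha2, _, ⟨a, ha0, rfl⟩, rfl⟩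
    · rintro x _ _ rfl h; exact Sum.inr.inj h
    · rintro x y _ rfl rfl; rfl
  · rintro D hD ⟨h, hh⟩
    change A.dom ⊕ V → D.dom at h
    obtain ⟨σ, kk, hσ⟩ := hmono (Option D.dom) (by rw [Finite.card_option]; omega)
      (fun x => some (h (Sum.inr x)))
    have hι := fun a : A.dom => mono_embed (Fin r) (Option D.dom) (n + 1)
      (by rw [Finite.card_option]; omega) (fun x => kk (a, x))
    choose ι hι using hι
    have hc : ∀ a, ∃ c, ∀ x, kk (a, ι a x) = c := by
      intro a
      rcases isEmpty_or_nonempty (Fin r) with hV | ⟨⟨x⟩⟩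
      · exact ⟨none, fun x => hV.elim x⟩
      · exact ⟨_, fun y => hι a y x⟩
    choose c hc using hc
    refine ⟨fun a => if nd a then (c a).getD (h (Sum.inl a)) else h (Sum.inl a), ?_, ?_⟩
    · intro R t ht
      let φ : Φ := ⟨⟨R, t, ht⟩, fun j => ι (t j) (Fin.castLE (hr R) j), by
        intro j j' hj
        simp only [Prod.mk.injEq] at hj
        rw [hj.1] at hj
        have := (ι (t j')).injective hj.2
        exact Fin.castLE_injective _ this⟩
      have h1 := hh.1 R (fun j => if nd (t j) then
        Sum.inr (v (σ φ) (t j, ι (t j) (Fin.castLE (hr R) j))) else Sum.inl (t j)) ⟨σ φ, by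
          have : F (σ φ) = ⟨(τ (σ φ)).1.1, fun j => if nd ((τ (σ φ)).1.2.1 j) then
            Sum.inr (v (σ φ) ((τ (σ φ)).1.2.1 j, (τ (σ φ)).2.1 j))
              else Sum.inl ((τ (σ φ)).1.2.1 j)⟩ := rfl
          rw [this, (hσ φ).1]; rfl⟩
      have heq : (fun j => if nd (t j) then (c (t j)).getD (h (Sum.inl (t j))) else
          h (Sum.inl (t j))) = fun j => h (if nd (t j) then
        Sum.inr (v (σ φ) (t j, ι (t j) (Fin.castLE (hr R) j))) else Sum.inl (t j)) := by
        funext j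
        by_cases hj : nd (t j)
        · rw [if_pos hj, if_pos hj]
          have := (hσ φ).2 (t j, ι (t j) (Fin.castLE (hr R) j)) (Finset.mem_univ _)
          rw [hc] at this
          rw [← this]
          rfl
        · rw [if_neg hj, if_neg hj]
      exact heq ▸ h1
    · intro i
      have : ¬ nd (A.dist i) := fun h => h i rfl
      simp only [this, if_false]
      exact hh.2 i

end P3

/-! ### Amalgams and patterns -/

section P4
variable {T : Type} {ar : T → ℕ}

lemma fact_ext {k : ℕ} {A : PStruct T ar k} {f f' : Fact A}
    (h : (⟨f.1, f.2.1⟩ : Σ R : T, Fin (ar R) → A.dom) = ⟨f'.1, f'.2.1⟩) : f = f' := by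
  obtain ⟨R, t, ht⟩ := f
  obtain ⟨R', t', ht'⟩ := f'
  obtain ⟨rfl, h1⟩ := Sigma.mk.inj h
  obtain rfl := eq_of_heq h1
  rfl

lemma ofFam_size_le {k : ℕ} (dom : Type) [Finite dom] {E : Type} [Finite E]
    (F : E → Σ R : T, Fin (ar R) → dom) (dist : Fin k → dom) :
    size (ofFam dom F dist) ≤ Nat.card E := by
  have hF : ∀ f : Fact (ofFam dom F dist), ∃ e, F e = ⟨f.1, f.2.1⟩ := fun f => f.2.2
  choose φ hφ using hF
  refine Nat.card_le_card_of_injective φ ?_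
  intro f f' h
  exact fact_ext ((hφ f).symm.trans ((congrArg F h).trans (hφ f')))

open Classical in
noncomputable def emb {k m : ℕ} {J : Type} {D : J → Type} (j : J) (d : Fin k → D j)
    (g : Fin k → Fin m) (x : D j) : Fin m ⊕ Σ j, D j :=
  if h : ∃ a, d a = x then Sum.inl (g h.choose) else Sum.inr ⟨j, x⟩

lemma emb_inr {k m : ℕ} {J : Type} {D : J → Type} {j : J} {d : Fin k → D j}
    {g : Fin k → Fin m} {x : D j} (h : ∀ a, Sum.inl a ≠ emb j d g x) :
    emb j d g x = Sum.inr ⟨j, x⟩ ∧ ∀ a, d a ≠ x := by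
  unfold emb at *
  split_ifs at * with h1
  · exact absurd rfl (h _)
  · exact ⟨rfl, fun a ha => h1 ⟨a, ha⟩⟩

lemma emb_dist {k m : ℕ} {J : Type} {D : J → Type} {j : J} {d : Fin k → D j}
    {g : Fin k → Fin m} (hc : ∀ a b, d a = d b → g a = g b) (a : Fin k) :
    emb j d g (d a) = Sum.inl (g a) := by
  unfold emb
  have h : ∃ b, d b = d a := ⟨a, rfl⟩
  rw [dif_pos h]
  exact congrArg Sum.inl (hc _ _ h.choose_spec)

lemma emb_elim {k m : ℕ} {J : Type} {D : J → Type} {j : J} {d : Fin k → D j}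
    {g : Fin k → Fin m} {Z : Type} (u : Fin m → Z) (w : ∀ j, D j → Z)
    (h : ∀ a, w j (d a) = u (g a)) (x : D j) :
    Sum.elim u (fun y : Σ j, D j => w y.1 y.2) (emb j d g x) = w j x := by
  unfold emb
  split_ifs with h1
  · rw [Sum.elim_inl, ← h, h1.choose_spec]
  · rfl

noncomputable def Am {J : Type} [Finite J] (m : ℕ) (K : J → ℕ) (B : ∀ j, PStruct T ar (K j))
    (g : ∀ j, Fin (K j) → Fin m) : PStruct T ar m :=
  ofFam (Fin m ⊕ Σ j, (B j).dom)
    (fun e : Σ j, Fact (B j) => ⟨e.2.1, fun i => emb e.1 (B e.1).dist (g e.1) (e.2.2.1 i)⟩) Sum.inl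

/-- Re-choose the distinguished elements. -/
def reD {k m : ℕ} (D : PStruct T ar m) (g : Fin k → Fin m) : PStruct T ar k where
  dom := D.dom
  finite := D.finite
  facts := D.facts
  dist i := D.dist (g i)

lemma Am_hom {J : Type} [Finite J] (m : ℕ) (K : J → ℕ) (B : ∀ j, PStruct T ar (K j))
    (g : ∀ j, Fin (K j) → Fin m) (hc : ∀ j a b, (B j).dist a = (B j).dist b → g j a = g j b)
    (D : PStruct T ar m) : HomTo (Am m K B g) D ↔ ∀ j, HomTo (B j) (reD D (g j)) := by
  constructor
  · rintro ⟨h, h1, h2⟩ j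
    change Fin m ⊕ (Σ j, (B j).dom) → D.dom at h
    refine ⟨fun x => h (emb j (B j).dist (g j) x), ?_, ?_⟩
    · intro R t ht
      exact h1 R (fun i => emb j (B j).dist (g j) (t i)) ⟨⟨j, R, t, ht⟩, rfl⟩
    · intro i
      change h (emb j (B j).dist (g j) ((B j).dist i)) = D.dist (g j i)
      rw [emb_dist (hc j)]
      exact h2 (g j i)
  · intro h
    choose h hh using h
    have he := fun j (x : (B j).dom) => emb_elim (j := j) (d := (B j).dist) (g := g j)
      (Z := D.dom) D.dist h (fun a => (hh j).2 a) x
    refine ⟨Sum.elim D.dist (fun y => h y.1 y.2), ?_, fun i => rfl⟩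
    rintro R t ⟨⟨j, f⟩, hf⟩
    obtain ⟨rfl, hf⟩ := Sigma.mk.inj hf
    have hf := eq_of_heq hf
    subst hf
    have h1 : (fun i => h j (f.2.1 i)) ∈ D.facts f.1 := (hh j).1 f.1 f.2.1 f.2.2
    have h2 : (fun i => h j (f.2.1 i)) = fun i =>
        Sum.elim D.dist (fun y : Σ j, (B j).dom => h y.1 y.2) (emb j (B j).dist (g j) (f.2.1 i)) := funext fun i => (he j _).symm
    exact h2 ▸ h1

lemma Am_gs {J : Type} [Finite J] (m : ℕ) (K : J → ℕ) (B : ∀ j, PStruct T ar (K j))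
    (g : ∀ j, Fin (K j) → Fin m) {gg : ℕ} (hB : ∀ j, GS (B j) gg) : GS (Am m K B g) gg := by
  have hF : ∀ f : Fact (Am m K B g), ∃ e : Σ j, Fact (B j),
    (⟨e.2.1, fun i => emb e.1 (B e.1).dist (g e.1) (e.2.2.1 i)⟩ :
      Σ R : T, Fin (ar R) → Fin m ⊕ Σ j, (B j).dom) = ⟨f.1, f.2.1⟩ := fun f => f.2.2
  have hval : ∀ (f : Fact (Am m K B g)) (e : Σ j, Fact (B j)),
    (⟨e.2.1, fun i => emb e.1 (B e.1).dist (g e.1) (e.2.2.1 i)⟩ :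
      Σ R : T, Fin (ar R) → Fin m ⊕ Σ j, (B j).dom) = ⟨f.1, f.2.1⟩ → ∀ i : Fin (ar f.1),
      (∀ a, (Am m K B g).dist a ≠ f.2.1 i) → ∃ i' : Fin (ar e.2.1), i'.1 = i.1 ∧
        f.2.1 i = Sum.inr ⟨e.1, e.2.2.1 i'⟩ ∧ ∀ a, (B e.1).dist a ≠ e.2.2.1 i' := by
    rintro ⟨R, t, ht⟩ e he i hi
    obtain ⟨rfl, he⟩ := Sigma.mk.inj he
    have he := eq_of_heq he
    simp only at he hi ⊢
    subst he
    exact ⟨i, rfl, emb_inr hi⟩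
  refine ⟨?_, ?_⟩
  · intro f i i' hi hii
    obtain ⟨e, he⟩ := hF f
    obtain ⟨a, ha1, ha2, ha3⟩ := hval f e he i hi
    obtain ⟨b, hb1, hb2, hb3⟩ := hval f e he i' (hii ▸ hi)
    have h1 := Sum.inr.inj (ha2.symm.trans (hii.trans hb2))
    have h2 := eq_of_heq (Sigma.mk.inj h1).2
    have := (hB e.1).1 e.2 a b ha3 h2
    exact Fin.ext (by rw [← ha1, ← hb1, this])
  · refine SparseG.of_comp (I := Option J)
      (Sum.elim (fun _ => none) (fun y => some y.1) : Fin m ⊕ (Σ j, (B j).dom) → Option J) ?_ ?_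
    · rintro f x y ⟨⟨i, rfl⟩, hx⟩ ⟨⟨i', rfl⟩, hy⟩
      obtain ⟨e, he⟩ := hF f
      obtain ⟨a, ha1, ha2, ha3⟩ := hval f e he i hx
      obtain ⟨b, hb1, hb2, hb3⟩ := hval f e he i' hy
      rw [ha2, hb2]
      rfl
    · rintro (_ | j)
      · rintro Y ⟨⟨f, x, ⟨⟨i, rfl⟩, hx⟩, hl⟩, hf⟩ _
        obtain ⟨e, he⟩ := hF f
        obtain ⟨a, ha1, ha2, ha3⟩ := hval f e he i hx
        rw [ha2] at hl
        cases hl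
      · have hF' : ∀ f : {f : Fact (Am m K B g) // ∃ x, nmem (Am m K B g) f x ∧
            (Sum.elim (fun _ => none) (fun y => some y.1) : Fin m ⊕ (Σ j, (B j).dom) → Option J) x
              = some j}, ∃ e : Fact (B j),
            (⟨e.1, fun i => emb j (B j).dist (g j) (e.2.1 i)⟩ :
              Σ R : T, Fin (ar R) → Fin m ⊕ Σ j, (B j).dom) = ⟨f.1.1, f.1.2.1⟩ := by
          rintro ⟨f, x, ⟨⟨i, rfl⟩, hx⟩, hl⟩
          obtain ⟨⟨j', e⟩, he⟩ := hF f
          obtain ⟨a, ha1, ha2, ha3⟩ := hval f ⟨j', e⟩ he i hx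
          rw [ha2] at hl
          obtain rfl : j' = j := Option.some.inj hl
          exact ⟨e, he⟩
        choose φ hφ using hF'
        refine (hB j).2.transfer φ ?_ (fun x x' => x = Sum.inr ⟨j, x'⟩) ?_ ?_ ?_
        · intro f f' h
          refine Subtype.ext (fact_ext ((hφ f).symm.trans (Eq.trans ?_ (hφ f'))))
          rw [h]
        · rintro f x ⟨⟨i, rfl⟩, hx⟩
          obtain ⟨a, ha1, ha2, ha3⟩ := hval f.1 ⟨j, φ f⟩ (hφ f) i hx
          exact ⟨_, ha2, ⟨a, rfl⟩, ha3⟩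
        · rintro x _ _ rfl h
          exact eq_of_heq (Sigma.mk.inj (Sum.inr.inj h)).2
        · rintro x y _ rfl rfl; rfl

lemma Am_size {J : Type} [Fintype J] [Finite T] (m : ℕ) (K : J → ℕ) (B : ∀ j, PStruct T ar (K j))
    (g : ∀ j, Fin (K j) → Fin m) : size (Am m K B g) ≤ ∑ j, size (B j) := by
  refine (ofFam_size_le _ _ _).trans ?_
  rw [Nat.card_sigma]
  rfl

variable {S : Type} {arS : S → ℕ}

/-- Patterns of source tuples. -/
abbrev Pat (arS : S → ℕ) : Type :=
  Σ R : S, Σ m : Fin (arS R + 1), {q : Fin (arS R) → Fin m.1 // Function.Surjective q}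

lemma exists_pat {R : S} {X : Type} (t : Fin (arS R) → X) :
    ∃ (m : Fin (arS R + 1)) (q : Fin (arS R) → Fin m.1) (g : Fin m.1 → X),
      Function.Surjective q ∧ Function.Injective g ∧ ∀ i, t i = g (q i) := by
  have : Finite (Set.range t) := Set.finite_range t
  obtain ⟨n, ⟨e⟩⟩ := Finite.exists_equiv_fin (Set.range t)
  have hs : Function.Surjective (fun i => e ⟨t i, i, rfl⟩) := by
    intro y
    obtain ⟨i, hi⟩ := (e.symm y).2
    refine ⟨i, ?_⟩
    apply e.symm.injective
    simp only [Equiv.symm_apply_apply]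
    exact Subtype.ext hi
  have hn : n ≤ arS R := by
    have := Fintype.card_le_of_surjective _ hs
    simpa using this
  exact ⟨⟨n, by omega⟩, fun i => e ⟨t i, i, rfl⟩, fun y => (e.symm y).1, hs,
    fun a b h => e.symm.injective (Subtype.ext h), fun i => by simp⟩

abbrev App {I : Type} (L : I → LavConstraint S T arS ar) (p : Pat arS) : Type :=
  {i : I // ∃ g : Fin (L i).m → Fin p.2.1.1,
    (⟨(L i).rel, fun x => g ((L i).pat x)⟩ : Σ R : S, Fin (arS R) → Fin p.2.1.1) = ⟨p.1, p.2.2.1⟩}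

noncomputable def agm {I : Type} (L : I → LavConstraint S T arS ar) (p : Pat arS) (j : App L p) :
    Fin (L j.1).m → Fin p.2.1.1 := j.2.choose

noncomputable def UU {I : Type} [Finite I] (L : I → LavConstraint S T arS ar) (p : Pat arS) :
    PStruct T ar p.2.1.1 :=
  Am p.2.1.1 (fun j : App L p => (L j.1).m) (fun j => (L j.1).rhs) (agm L p)

def Cons {I : Type} (L : I → LavConstraint S T arS ar) (p : Pat arS) : Prop :=
  ∀ (j : App L p) a b, (L j.1).rhs.dist a = (L j.1).rhs.dist b → agm L p j a = agm L p j b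

/-- Target part of an example with given distinguished elements. -/
def tg {m : ℕ} (e : SMExample S T arS ar) (g : Fin m → e.dom) : PStruct T ar m where
  dom := e.dom
  finite := e.finite
  facts R := e.facts (Sum.inr R)
  dist := g

lemma sat_local {I : Type} [Finite I] (L : I → LavConstraint S T arS ar) (p : Pat arS)
    (e : SMExample S T arS ar) (he : Sat e (Set.range L)) (g : Fin p.2.1.1 → e.dom)
    (hg : Function.Injective g) (ht : (fun i => g (p.2.2.1 i)) ∈ e.facts (Sum.inl p.1)) :
    Cons L p ∧ HomTo (UU L p) (tg e g) := by
  have key : ∀ j : App L p, HomTo (L j.1).rhs (reD (tg e g) (agm L p j)) := by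
    intro j
    have hs := j.2.choose_spec
    have hr := he (L j.1) ⟨_, rfl⟩
    have : ∀ (R : S) (q : Fin (arS R) → Fin p.2.1.1), (fun i => g (q i)) ∈ e.facts (Sum.inl R) →
        (⟨(L j.1).rel, fun x => agm L p j ((L j.1).pat x)⟩ : Σ R : S, Fin (arS R) → Fin p.2.1.1)
          = ⟨R, q⟩ → HomTo (L j.1).rhs (reD (tg e g) (agm L p j)) := by
      intro R q hq heq
      obtain ⟨rfl, h2⟩ := Sigma.mk.inj heq
      have h2 := eq_of_heq h2
      subst h2
      exact hr _ hq (fun x => g (agm L p j x)) (fun i => rfl)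
    exact this _ _ ht hs
  have hc : Cons L p := by
    intro j a b hab
    obtain ⟨h, hh⟩ := key j
    apply hg
    have := (hh.2 a).symm.trans ((congrArg h hab).trans (hh.2 b))
    exact this
  exact ⟨hc, (Am_hom _ _ _ _ hc _).2 key⟩

lemma sat_of_local {I : Type} [Finite I] (L : I → LavConstraint S T arS ar)
    (e : SMExample S T arS ar)
    (h : ∀ (R : S) (t : Fin (arS R) → e.dom), t ∈ e.facts (Sum.inl R) →
      ∃ (m : Fin (arS R + 1)) (q : Fin (arS R) → Fin m.1) (g : Fin m.1 → e.dom)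
        (hq : Function.Surjective q), Function.Injective g ∧ (∀ i, t i = g (q i)) ∧
        Cons L ⟨R, m, q, hq⟩ ∧ HomTo (UU L ⟨R, m, q, hq⟩) (tg e g)) :
    Sat e (Set.range L) := by
  rintro _ ⟨i, rfl⟩ t ht g' hg'
  obtain ⟨m, q, g, hq, hg, htq, hc, hU⟩ := h _ t ht
  have : ∀ y : Fin (L i).m, ∃ z : Fin m.1, g z = g' y := by
    intro y
    obtain ⟨x, rfl⟩ := (L i).surj y
    exact ⟨q x, (htq x).symm.trans (hg' x)⟩
  choose g1 hg1 using this
  have hg2 : (⟨(L i).rel, fun x => g1 ((L i).pat x)⟩ : Σ R : S, Fin (arS R) → Fin m.1) =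
      ⟨(L i).rel, q⟩ := by
    congr 1
    funext x
    apply hg
    exact (hg1 _).trans ((hg' x).symm.trans (htq x))
  let j : App L ⟨(L i).rel, m, q, hq⟩ := ⟨i, g1, hg2⟩
  obtain ⟨s, hs⟩ := (Am_hom _ _ _ _ hc _).1 hU j
  refine ⟨s, hs.1, fun y => (hs.2 y).trans ?_⟩
  change g (agm L _ j y) = g' y
  have hsp := j.2.choose_spec
  have hsp := eq_of_heq (Sigma.mk.inj hsp).2
  obtain ⟨x, rfl⟩ := (L i).surj y
  have := congrFun hsp x
  refine (congrArg g this).trans ?_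
  exact (htq x).symm.trans (hg' x)

lemma logEquiv_of {I I' : Type} [Finite I] [Finite I'] (L : I → LavConstraint S T arS ar)
    (L' : I' → LavConstraint S T arS ar)
    (h : ∀ p : Pat arS, (Cons L p ↔ Cons L' p) ∧ (Cons L p →
      ∀ D, Function.Injective D.dist → (HomTo (UU L p) D ↔ HomTo (UU L' p) D))) :
    LogEquiv (Set.range L) (Set.range L') := by
  intro e
  constructor
  · intro he
    apply sat_of_local
    intro R t ht
    obtain ⟨m, q, g, hq, hg, htq⟩ := exists_pat t
    have ht' : t = fun i => g (q i) := funext htq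
    obtain ⟨h1, h2⟩ := sat_local L ⟨R, m, q, hq⟩ e he g hg (ht' ▸ ht)
    exact ⟨m, q, g, hq, hg, htq, (h _).1.1 h1, ((h _).2 h1 _ hg).1 h2⟩
  · intro he
    apply sat_of_local
    intro R t ht
    obtain ⟨m, q, g, hq, hg, htq⟩ := exists_pat t
    have ht' : t = fun i => g (q i) := funext htq
    obtain ⟨h1, h2⟩ := sat_local L' ⟨R, m, q, hq⟩ e he g hg (ht' ▸ ht)
    have h1 := (h _).1.2 h1
    exact ⟨m, q, g, hq, hg, htq, h1, ((h _).2 h1 _ hg).2 h2⟩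

/-- The example consisting of one source fact of pattern `p` and target instance `B`. -/
def mkE (p : Pat arS) (B : PStruct T ar p.2.1.1) : SMExample S T arS ar where
  dom := B.dom
  finite := B.finite
  facts R := match R with
    | Sum.inl R' => {t | (⟨R', t⟩ : Σ R : S, Fin (arS R) → B.dom) =
        ⟨p.1, fun i => B.dist (p.2.2.1 i)⟩}
    | Sum.inr R' => B.facts R'
  dist := Fin.elim0

lemma sat_mkE {I : Type} [Finite I] (L : I → LavConstraint S T arS ar) (p : Pat arS)
    (B : PStruct T ar p.2.1.1) (hB : Function.Injective B.dist) :
    Sat (mkE p B) (Set.range L) ↔ Cons L p ∧ HomTo (UU L p) B := by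
  constructor
  · intro h
    exact sat_local L p (mkE p B) h B.dist hB rfl
  · rintro ⟨h1, h2⟩
    apply sat_of_local
    intro R t ht
    have ht : (⟨R, t⟩ : Σ R : S, Fin (arS R) → B.dom) = ⟨p.1, fun i => B.dist (p.2.2.1 i)⟩ := ht
    obtain ⟨R0, m, q, hq⟩ := p
    obtain ⟨rfl, ht⟩ := Sigma.mk.inj ht
    have ht := eq_of_heq ht
    subst ht
    exact ⟨m, q, B.dist, hq, hB, fun _ => rfl, h1, h2⟩

lemma size_mkE [Finite S] [Finite T] (p : Pat arS) (B : PStruct T ar p.2.1.1) :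
    size (mkE p B) ≤ size B + 1 := by
  let φ : Fact (mkE p B) → Option (Fact B) := fun f => match f with
    | ⟨Sum.inl _, _⟩ => none
    | ⟨Sum.inr R, t⟩ => some ⟨R, t.1, t.2⟩
  have hφ : Function.Injective φ := by
    rintro ⟨R | R, t, ht⟩ ⟨R' | R', t', ht'⟩ h
    · have ht : (⟨R, t⟩ : Σ R : S, Fin (arS R) → B.dom) = _ := ht
      have ht' : (⟨R', t'⟩ : Σ R : S, Fin (arS R) → B.dom) = _ := ht'
      have := ht.trans ht'.symm
      obtain ⟨rfl, h2⟩ := Sigma.mk.inj this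
      have h2 := eq_of_heq h2
      subst h2
      rfl
    · cases h
    · cases h
    · have h := Option.some.inj h
      obtain ⟨rfl, h⟩ := Sigma.mk.inj h
      have h := congrArg Subtype.val (eq_of_heq h)
      have h : t = t' := h
      subst h
      rfl
  have := Nat.card_le_card_of_injective φ hφ
  rw [Finite.card_option] at this
  exact this

end P4

/-! ### Cores and frontiers -/

section P5
variable {T : Type} {ar : T → ℕ} {k : ℕ}

lemma PStruct.HomTo.trans {A B C : PStruct T ar k} (h1 : HomTo A B) (h2 : HomTo B C) : HomTo A C := by
  obtain ⟨f, hf⟩ := h1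
  obtain ⟨g, hg⟩ := h2
  exact ⟨fun x => g (f x), fun R t ht => hg.1 R _ (hf.1 R t ht),
    fun i => (congrArg g (hf.2 i)).trans (hg.2 i)⟩

lemma PStruct.HomTo.refl (A : PStruct T ar k) : HomTo A A :=
  ⟨fun x => x, fun _ _ ht => ht, fun _ => rfl⟩

/-- Induced substructure. -/
def restr (A : PStruct T ar k) (P : Set A.dom) (hd : ∀ i, A.dist i ∈ P) : PStruct T ar k where
  dom := P
  finite := inferInstance
  facts R := {t | (fun i => (t i).1) ∈ A.facts R}
  dist i := ⟨A.dist i, hd i⟩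

lemma restr_isHom (A : PStruct T ar k) (P : Set A.dom) (hd : ∀ i, A.dist i ∈ P) :
    IsHom (restr A P hd) A Subtype.val := ⟨fun _ _ ht => ht, fun _ => rfl⟩

lemma size_le_of_inj [Finite T] {A B : PStruct T ar k} {h : A.dom → B.dom} (hh : IsHom A B h)
    (hi : Function.Injective h) : size A ≤ size B := by
  refine Nat.card_le_card_of_injective
    (fun f : Fact A => (⟨f.1, _, hh.1 f.1 f.2.1 f.2.2⟩ : Fact B)) ?_
  rintro ⟨R, t, ht⟩ ⟨R', t', ht'⟩ he
  obtain ⟨rfl, he⟩ := Sigma.mk.inj he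
  have he := congrArg Subtype.val (eq_of_heq he)
  have : t = t' := by
    funext i; exact hi (congrFun he i)
  subst this; rfl

lemma exists_core [Finite T] (A : PStruct T ar k) (hA : Function.Injective A.dist)
    (hg : ∀ g, GS A g) : ∃ B : PStruct T ar k, HomEquiv A B ∧ Function.Injective B.dist ∧
      (∀ g, GS B g) ∧ size B ≤ size A ∧ ∀ h, IsHom B B h → Function.Bijective h := by
  classical
  let P : ℕ → Prop := fun n => ∃ B : PStruct T ar k, Nat.card B.dom = n ∧ HomEquiv A B ∧
    Function.Injective B.dist ∧ (∀ g, GS B g) ∧ size B ≤ size A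
  have hP : ∃ n, P n := ⟨_, A, rfl, ⟨.refl A, .refl A⟩, hA, hg, le_rfl⟩
  obtain ⟨B, hc, he, hi, hgs, hs⟩ := Nat.find_spec hP
  refine ⟨B, he, hi, hgs, hs, fun h hh => ?_⟩
  have hd : ∀ i, B.dist i ∈ Set.range h := fun i => ⟨B.dist i, hh.2 i⟩
  have hR := restr_isHom B (Set.range h) hd
  have hBR : HomTo B (restr B (Set.range h) hd) :=
    ⟨fun x => ⟨h x, x, rfl⟩, fun R t ht => hh.1 R t ht, fun i => Subtype.ext (hh.2 i)⟩
  have hmin := Nat.find_min' hP (m := Nat.card (Set.range h))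
    ⟨restr B (Set.range h) hd, rfl, ⟨he.1.trans hBR, HomTo.trans ⟨_, hR⟩ he.2⟩,
      fun i j hij => hi (congrArg Subtype.val hij),
      fun g => (hgs g).sub _ hR Subtype.val_injective,
      (size_le_of_inj hR Subtype.val_injective).trans hs⟩
  have hsurj : Function.Surjective h := by
    rw [← Set.range_eq_univ]
    apply Set.eq_of_subset_of_ncard_le (Set.subset_univ _)
    rw [Set.ncard_univ, hc]
    exact hmin
  exact Finite.surjective_iff_bijective.1 hsurj

/-- One member of the frontier. -/
def FF [Finite T] (A : PStruct T ar k) (Y : Fact A → Prop) : PStruct T ar k where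
  dom := A.dom × Option (Fact A)
  finite := inferInstance
  facts R := {t | ∃ hf : (fun j => (t j).1) ∈ A.facts R, Y ⟨R, _, hf⟩ →
    (∀ j, (∀ i, A.dist i ≠ (t j).1) → ∃ f', nmem A f' (t j).1 ∧ (t j).2 = some f') ∧
    ∃ j, ((∀ i, A.dist i ≠ (t j).1) ∧ (t j).2 ≠ some ⟨R, _, hf⟩) ∨
      ((∃ i, A.dist i = (t j).1) ∧ (t j).2 ≠ none)}
  dist i := (A.dist i, none)

lemma FF_homTo [Finite T] (A : PStruct T ar k) (Y : Fact A → Prop) : HomTo (FF A Y) A :=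
  ⟨Prod.fst, fun _ _ ht => ht.1, fun _ => rfl⟩

lemma FF_size [Finite T] (A : PStruct T ar k) (Y : Fact A → Prop) (r : ℕ) (hr : ∀ R, ar R ≤ r) :
    size (FF A Y) ≤ size A * (size A + 1) ^ r := by
  classical
  let φ : Fact (FF A Y) → Fact A × (Fin r → Option (Fact A)) := fun f =>
    (⟨f.1, _, f.2.2.1⟩, fun j => if h : j.1 < ar f.1 then (f.2.1 ⟨j.1, h⟩).2 else none)
  have hφ : Function.Injective φ := by
    rintro ⟨R, t, ht⟩ ⟨R', t', ht'⟩ he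
    have he1 := congrArg Prod.fst he
    have he2 := congrArg Prod.snd he
    obtain ⟨rfl, h1⟩ := Sigma.mk.inj he1
    have h1 := congrArg Subtype.val (eq_of_heq h1)
    have h1 : (fun j => (t j).1) = fun j => (t' j).1 := h1
    have : t = t' := by
      funext j
      apply Prod.ext
      · exact congrFun h1 j
      · have := congrFun he2 ⟨j.1, lt_of_lt_of_le j.2 (hr R)⟩
        simpa [φ] using this
    subst this; rfl
  refine (Nat.card_le_card_of_injective φ hφ).trans ?_
  rw [Nat.card_prod, Nat.card_fun, Finite.card_option, Nat.card_fin]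
  rfl

/-- A bijective hom of a finite structure has an inverse that is an iterate. -/
lemma section_of_core [Finite T] (A F : PStruct T ar k) (π : F.dom → A.dom) (hπ : IsHom F A π)
    (hcore : ∀ h, IsHom A A h → Function.Bijective h) (h : HomTo A F) :
    ∃ s, IsHom A F s ∧ ∀ x, π (s x) = x := by
  obtain ⟨s, hs⟩ := h
  have he : IsHom A A (fun x => π (s x)) :=
    ⟨fun R t ht => hπ.1 R _ (hs.1 R t ht), fun i => (congrArg π (hs.2 i)).trans (hπ.2 i)⟩
  have hb := hcore _ he
  let e : Equiv.Perm A.dom := Equiv.ofBijective _ hb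
  have hit : ∀ n : ℕ, IsHom A A (fun x => (e ^ n) x) := by
    intro n
    induction n with
    | zero => exact ⟨fun _ _ ht => ht, fun _ => rfl⟩
    | succ n ih =>
      refine ⟨fun R t ht => ?_, fun i => ?_⟩
      · have := he.1 R _ (ih.1 R t ht)
        simpa [pow_succ', e] using this
      · have := (congrArg e (ih.2 i)).trans (he.2 i)
        simpa [pow_succ', e] using this
  have hpos : 0 < orderOf e := orderOf_pos e
  refine ⟨fun x => s ((e ^ (orderOf e - 1)) x), ⟨fun R t ht => hs.1 R _ ((hit _).1 R t ht),
    fun i => (congrArg s ((hit _).2 i)).trans (hs.2 i)⟩, fun x => ?_⟩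
  change e ((e ^ (orderOf e - 1)) x) = x
  rw [← Equiv.Perm.mul_apply, ← pow_succ', Nat.sub_add_cancel hpos, pow_orderOf_eq_one]
  rfl

variable [Finite T] (A : PStruct T ar k)

structure FCert (A : PStruct T ar k) where
  par : A.dom → Fact A
  r : Fact A → Fact A
  rk : Fact A → ℕ
  c1 : ∀ f b, nmem A f b → nmem A (par b) b
  c2 : ∀ f b, nmem A f b → par b ≠ f → rk (par b) < rk f
  c3 : ∀ f b b', nmem A f b → nmem A f b' → par b ≠ f → par b' ≠ f → b = b'
  c4 : ∀ f b, nmem A f b → r (par b) = r f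
  c5 : ∀ f, r f = f → ∀ b, nmem A f b → par b = f
  c7 : ∀ f, r f ≠ f → ∃ b, nmem A f b ∧ par b ≠ f

lemma exists_fcert (hg : ∀ g, GS A g) [Nonempty (Fact A)] : Nonempty (FCert A) := by
  have := Fintype.ofFinite (Fact A)
  obtain ⟨c⟩ := exists_cert (nmem A) _ Finset.univ rfl
    (fun Z _ hZ => (hg Z.card).2 Z hZ le_rfl)
  have u := fun f : Fact A => Finset.mem_univ f
  exact ⟨⟨c.par, c.r, c.rk, fun f b h => (c.c1 f (u f) b h).2, fun f => c.c2 f (u f),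
    fun f => c.c3 f (u f), fun f => c.c4 f (u f), fun f => c.c5 f (u f), fun f => c.c7 f (u f)⟩⟩

variable {A}

lemma FF_not (c : FCert A) (hcore : ∀ h, IsHom A A h → Function.Bijective h) (f0 : Fact A)
    (hf0 : c.r f0 = f0) : ¬ HomTo A (FF A (fun f => c.r f = f0)) := by
  intro h
  obtain ⟨s, hs, hsec⟩ := section_of_core A (FF A (fun f => c.r f = f0)) Prod.fst
    ⟨fun _ _ ht => ht.1, fun _ => rfl⟩ hcore h
  have step : ∀ f : Fact A, c.r f = f0 → ∃ b f', nmem A f b ∧ nmem A f' b ∧ (s b).2 = some f' ∧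
      f' ≠ f := by
    rintro ⟨R, t, ht⟩ hr
    obtain ⟨hf, hY⟩ := hs.1 R t ht
    have hfeq : (⟨R, fun j => (s (t j)).1, hf⟩ : Fact A) = ⟨R, t, ht⟩ := by
      apply fact_ext
      simp only [hsec]
    rw [hfeq] at hY
    obtain ⟨h1, j, ⟨h2, h3⟩ | ⟨⟨i, h2⟩, h3⟩⟩ := hY hr
    · obtain ⟨f', hf', hf''⟩ := h1 j h2
      have hj : (s (t j)).1 = t j := hsec _
      rw [hj] at h2 hf'
      exact ⟨t j, f', ⟨⟨j, rfl⟩, h2⟩, hf', hf'', fun he => h3 (by rw [hf'', he])⟩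
    · exfalso
      apply h3
      have hj : (s (t j)).1 = t j := hsec _
      rw [hj] at h2
      exact congrArg Prod.snd ((congrArg s h2.symm).trans (hs.2 i))
  have climb : ∀ n : ℕ, ∃ f : Fact A, c.r f = f0 ∧ n ≤ c.rk f ∧
      ∀ b, nmem A f b → c.par b ≠ f → (s b).2 = some f := by
    intro n
    induction n with
    | zero => exact ⟨f0, hf0, Nat.zero_le _, fun b hb hp => absurd (c.c5 f0 hf0 b hb) hp⟩
    | succ n ih =>
      obtain ⟨f, hr, hn, hinv⟩ := ih
      obtain ⟨b, f', hb, hb', hs', hne⟩ := step f hr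
      have hpar : c.par b = f := by
        by_contra hp
        have := hinv b hb hp
        rw [hs'] at this
        exact hne (Option.some.inj this)
      have hp' : c.par b ≠ f' := by rw [hpar]; exact hne.symm
      refine ⟨f', ?_, ?_, ?_⟩
      · rw [← c.c4 f' b hb', hpar, hr]
      · have := c.c2 f' b hb' hp'
        rw [hpar] at this
        omega
      · intro b2 hb2 hp2
        rw [c.c3 f' b2 b hb2 hb' hp2 hp', hs']
  obtain ⟨m, hm⟩ := (Set.finite_range c.rk).bddAbove
  obtain ⟨f, _, hf, _⟩ := climb (m + 1)
  have := hm ⟨f, rfl⟩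
  omega

/-- `Okp par b c`: the part of `A` below `b` maps to `C` with `b` going to `c`. -/
inductive Okp (A C : PStruct T ar k) (par : A.dom → Fact A) : A.dom → C.dom → Prop
  | mk (b : A.dom) (c : C.dom) (t : ∀ f : Fact A, Fin (ar f.1) → C.dom)
      (h1 : ∀ f, nmem A f b → f ≠ par b → t f ∈ C.facts f.1)
      (h2 : ∀ f, nmem A f b → f ≠ par b → ∀ j i, A.dist i = f.2.1 j → t f j = C.dist i)
      (h3 : ∀ f, nmem A f b → f ≠ par b → ∀ j, f.2.1 j = b → t f j = c)
      (h4 : ∀ f, nmem A f b → f ≠ par b → ∀ j, (∀ i, A.dist i ≠ f.2.1 j) → f.2.1 j ≠ b →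
        Okp A C par (f.2.1 j) (t f j)) : Okp A C par b c

def Wit (C : PStruct T ar k) (par : A.dom → Fact A) (f : Fact A) (b : A.dom) (c : C.dom)
    (u : Fin (ar f.1) → C.dom) : Prop :=
  u ∈ C.facts f.1 ∧ (∀ j i, A.dist i = f.2.1 j → u j = C.dist i) ∧
    (∀ j, f.2.1 j = b → u j = c) ∧
    ∀ j, (∀ i, A.dist i ≠ f.2.1 j) → f.2.1 j ≠ b → Okp A C par (f.2.1 j) (u j)

lemma okp_iff (C : PStruct T ar k) (par : A.dom → Fact A) (b : A.dom) (c : C.dom) :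
    Okp A C par b c ↔ ∀ f, nmem A f b → f ≠ par b → ∃ u, Wit C par f b c u := by
  constructor
  · rintro ⟨_, _, t, h1, h2, h3, h4⟩ f hf hp
    exact ⟨t f, h1 f hf hp, h2 f hf hp, h3 f hf hp, h4 f hf hp⟩
  · intro h
    have : ∀ f : Fact A, ∃ u, nmem A f b → f ≠ par b → Wit C par f b c u := by
      intro f
      by_cases hf : nmem A f b ∧ f ≠ par b
      · obtain ⟨u, hu⟩ := h f hf.1 hf.2
        exact ⟨u, fun _ _ => hu⟩
      · exact ⟨fun _ => c, fun h1 h2 => absurd ⟨h1, h2⟩ hf⟩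
    choose t ht using this
    exact ⟨b, c, t, fun f h1 h2 => (ht f h1 h2).1, fun f h1 h2 => (ht f h1 h2).2.1,
      fun f h1 h2 => (ht f h1 h2).2.2.1, fun f h1 h2 => (ht f h1 h2).2.2.2⟩

lemma FF_root (hA : Function.Injective A.dist) (nr : NonRep A) (c : FCert A) (f0 : Fact A)
    (C : PStruct T ar k) (hCA : HomTo C A) (hC : ¬ HomTo C (FF A (fun f => c.r f = f0))) :
    ∃ u ∈ C.facts f0.1, (∀ j i, A.dist i = f0.2.1 j → u j = C.dist i) ∧
      ∀ j, (∀ i, A.dist i ≠ f0.2.1 j) → Okp A C c.par (f0.2.1 j) (u j) := by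
  classical
  obtain ⟨h, hh⟩ := hCA
  have hlab : ∀ x : C.dom, ∃ l : Option (Fact A),
      ((∃ i, A.dist i = h x) → ((∃ i, C.dist i = x) → l = none) ∧ (l = none → ∃ i, C.dist i = x)) ∧
      ((∀ i, A.dist i ≠ h x) → (Okp A C c.par (h x) x → l = some (c.par (h x))) ∧
        (¬ Okp A C c.par (h x) x → ∃ f, nmem A f (h x) ∧ f ≠ c.par (h x) ∧ l = some f ∧
          ∀ u, ¬ Wit C c.par f (h x) x u)) := by
    intro x
    by_cases hd : ∃ i, A.dist i = h x
    · by_cases hx : ∃ i, C.dist i = x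
      · exact ⟨none, fun _ => ⟨fun _ => rfl, fun _ => hx⟩, fun h => absurd hd (by push Not; exact h)⟩
      · exact ⟨some f0, fun _ => ⟨fun h => absurd h hx, fun h => by cases h⟩,
          fun h => absurd hd (by push Not; exact h)⟩
    · by_cases hok : Okp A C c.par (h x) x
      · exact ⟨some (c.par (h x)), fun h => absurd h hd, fun _ => ⟨fun _ => rfl, fun h => absurd hok h⟩⟩
      · have := hok
        rw [okp_iff] at this
        push Not at this
        obtain ⟨f, h1, h2, h3⟩ := this
        exact ⟨some f, fun h => absurd h hd, fun _ => ⟨fun h => absurd h hok,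
          fun _ => ⟨f, h1, h2, rfl, h3⟩⟩⟩
  choose lab hlab1 hlab2 using hlab
  by_contra hno
  apply hC
  refine ⟨fun x => (h x, lab x), ?_, ?_⟩
  · intro R u hu
    have hf := hh.1 R u hu
    refine ⟨hf, fun hY => ?_⟩
    let f : Fact A := ⟨R, fun j => h (u j), hf⟩
    have hnm : ∀ j, (∀ i, A.dist i ≠ h (u j)) → nmem A f (h (u j)) := fun j hj => ⟨⟨j, rfl⟩, hj⟩
    constructor
    · intro j hj
      change ∀ i, A.dist i ≠ h (u j) at hj
      change ∃ f', nmem A f' (h (u j)) ∧ lab (u j) = some f'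
      by_cases hok : Okp A C c.par (h (u j)) (u j)
      · exact ⟨_, c.c1 f _ (hnm j hj), (hlab2 _ hj).1 hok⟩
      · obtain ⟨f', h1, _, h3, _⟩ := (hlab2 _ hj).2 hok
        exact ⟨f', h1, h3⟩
    · by_contra hall
      push Not at hall
      have a1 : ∀ j, (∀ i, A.dist i ≠ h (u j)) → lab (u j) = some f := fun j hj => (hall j).1 hj
      have a2 : ∀ j, (∃ i, A.dist i = h (u j)) → lab (u j) = none := fun j hj => (hall j).2 hj
      have hdist : ∀ j i, A.dist i = f.2.1 j → u j = C.dist i := by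
        intro j i hi
        obtain ⟨i', hi'⟩ := (hlab1 (u j) ⟨i, hi⟩).2 (a2 j ⟨i, hi⟩)
        have : i = i' := by
          apply hA
          rw [hi, ← hh.2 i', hi']
        rw [this, hi']
      have hok : ∀ j, (∀ i, A.dist i ≠ h (u j)) → c.par (h (u j)) = f →
          Okp A C c.par (h (u j)) (u j) := by
        intro j hj hp
        by_contra hn
        obtain ⟨f', h1, h2, h3, _⟩ := (hlab2 _ hj).2 hn
        rw [a1 j hj] at h3
        exact h2 (by rw [hp]; exact (Option.some.inj h3).symm)
      by_cases hroot : c.r f = f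
      · have hff : f0 = f := hY.symm.trans hroot
        apply hno
        subst hff
        refine ⟨u, hu, hdist, fun j hj => hok j hj (c.c5 _ hroot _ (hnm j hj))⟩
      · obtain ⟨b, ⟨⟨j, hj⟩, hbd⟩, hp⟩ := c.c7 f hroot
        change h (u j) = b at hj
        subst hj
        have hnok : ¬ Okp A C c.par (h (u j)) (u j) := by
          intro hk
          have := (hlab2 _ hbd).1 hk
          rw [a1 j hbd] at this
          exact hp (Option.some.inj this).symm
        obtain ⟨f', h1, h2, h3, h4⟩ := (hlab2 _ hbd).2 hnok
        rw [a1 j hbd] at h3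
        obtain rfl := Option.some.inj h3
        refine h4 u ⟨hu, hdist, ?_, ?_⟩
        · intro j' hj'
          have : j = j' := nr f j j' hbd hj'.symm
          rw [this]
        · intro j' hj' hne
          refine hok j' hj' ?_
          by_contra hp'
          exact hne (c.c3 f _ _ (hnm j' hj') h1 hp' hp)
  · intro i
    have : lab (C.dist i) = none := (hlab1 _ ⟨i, (hh.2 i).symm⟩).1 ⟨i, rfl⟩
    change (h (C.dist i), lab (C.dist i)) = (A.dist i, none)
    rw [this, hh.2 i]

lemma FF_glue (hA : Function.Injective A.dist) (nr : NonRep A) (c : FCert A)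
    (C : PStruct T ar k) (s0 : A.dom → C.dom) (hs0 : ∀ i, s0 (A.dist i) = C.dist i)
    (hroot : ∀ f0, c.r f0 = f0 → ∃ u ∈ C.facts f0.1,
      (∀ j i, A.dist i = f0.2.1 j → u j = C.dist i) ∧
      ∀ j, (∀ i, A.dist i ≠ f0.2.1 j) → Okp A C c.par (f0.2.1 j) (u j)) : HomTo A C := by
  classical
  have main : ∀ n : ℕ, ∃ s : A.dom → C.dom, (∀ i, s (A.dist i) = C.dist i) ∧
      (∀ f : Fact A, c.rk f < n → (fun j => s (f.2.1 j)) ∈ C.facts f.1) ∧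
      ∀ f b, nmem A f b → c.rk (c.par b) < n → Okp A C c.par b (s b) := by
    intro n
    induction n with
    | zero => exact ⟨s0, hs0, fun f h => absurd h (by omega), fun f b _ h => absurd h (by omega)⟩
    | succ n ih =>
      obtain ⟨s, hs1, hs2, hs3⟩ := ih
      have hu : ∀ f : Fact A, ∃ u : Fin (ar f.1) → C.dom, c.rk f = n →
          u ∈ C.facts f.1 ∧ (∀ j i, A.dist i = f.2.1 j → u j = C.dist i) ∧
          (∀ j, nmem A f (f.2.1 j) → c.par (f.2.1 j) ≠ f → u j = s (f.2.1 j)) ∧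
          ∀ j, nmem A f (f.2.1 j) → c.par (f.2.1 j) = f → Okp A C c.par (f.2.1 j) (u j) := by
        intro f
        by_cases hn : c.rk f = n
        · by_cases hr : c.r f = f
          · obtain ⟨u, h1, h2, h3⟩ := hroot f hr
            exact ⟨u, fun _ => ⟨h1, h2, fun j hj hp => absurd (c.c5 f hr _ hj) hp,
              fun j hj _ => h3 j hj.2⟩⟩
          · obtain ⟨b, hb, hp⟩ := c.c7 f hr
            have hlt := c.c2 f b hb hp
            have hok := hs3 f b hb (by omega)
            obtain ⟨u, h1, h2, h3, h4⟩ := (okp_iff _ _ _ _).1 hok f hb hp.symm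
            refine ⟨u, fun _ => ⟨h1, h2, ?_, ?_⟩⟩
            · intro j hj hpj
              have := c.c3 f _ _ hj hb hpj hp
              rw [h3 j this, this]
            · intro j hj hpj
              exact h4 j hj.2 (fun he => hp (by rw [← he]; exact hpj))
        · exact ⟨fun j => s (f.2.1 j), fun h => absurd h hn⟩
      choose u hu using hu
      let new : A.dom → Prop := fun x => nmem A (c.par x) x ∧ c.rk (c.par x) = n
      let s' : A.dom → C.dom := fun x =>
        if h : new x then u (c.par x) h.1.1.choose else s x
      have hs'new : ∀ (f : Fact A) (j), nmem A f (f.2.1 j) → c.par (f.2.1 j) = f → c.rk f = n →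
          s' (f.2.1 j) = u f j := by
        intro f j hj hp hn
        have hnew : new (f.2.1 j) := ⟨c.c1 f _ hj, by rw [hp]; exact hn⟩
        have hex : ∀ (f' : Fact A), f' = f → ∀ (hx : ∃ j', f'.2.1 j' = f.2.1 j),
            u f' hx.choose = u f j := by
          rintro f' rfl hx
          have := nr f' j hx.choose hj.2 hx.choose_spec.symm
          rw [← this]
        simp only [s', dif_pos hnew]
        exact hex _ hp _
      have hs'old : ∀ x, ¬ new x → s' x = s x := fun x hx => by simp only [s', dif_neg hx]
      have hs'd : ∀ i, s' (A.dist i) = C.dist i := by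
        intro i
        rw [hs'old _ (fun h => h.1.2 i rfl), hs1]
      refine ⟨s', hs'd, ?_, ?_⟩
      · intro f hf
        by_cases hn : c.rk f = n
        · obtain ⟨h1, h2, h3, h4⟩ := hu f hn
          convert h1 using 1
          funext j
          by_cases hd : ∃ i, A.dist i = f.2.1 j
          · obtain ⟨i, hi⟩ := hd
            rw [h2 j i hi, ← hi, hs'd]
          · push Not at hd
            have hj : nmem A f (f.2.1 j) := ⟨⟨j, rfl⟩, hd⟩
            by_cases hp : c.par (f.2.1 j) = f
            · exact hs'new f j hj hp hn
            · rw [h3 j hj hp]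
              apply hs'old
              intro h
              have := c.c2 f _ hj hp
              have := h.2
              omega
        · have := hs2 f (by omega)
          convert this using 2
          rename_i j
          apply hs'old
          intro h
          have hj : nmem A f (f.2.1 j) := ⟨⟨j, rfl⟩, h.1.2⟩
          by_cases hp : c.par (f.2.1 j) = f
          · have := h.2
            rw [hp] at this
            exact hn this
          · have := c.c2 f _ hj hp
            have := h.2
            omega
      · intro f b hb hn
        by_cases hnew : new b
        · obtain ⟨⟨⟨j, hj⟩, hd⟩, hk⟩ := id hnew
          obtain ⟨h1, h2, h3, h4⟩ := hu _ hk
          have hjj : nmem A (c.par b) ((c.par b).2.1 j) := by rw [hj]; exact hnew.1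
          have e1 := hs'new (c.par b) j hjj (by rw [hj]) hk
          have e2 := h4 j hjj (by rw [hj])
          rw [← e1, hj] at e2
          exact e2
        · rw [hs'old b hnew]
          refine hs3 f b hb ?_
          have : c.rk (c.par b) ≠ n := fun h => hnew ⟨c.c1 f b hb, h⟩
          omega
  obtain ⟨m, hm⟩ := (Set.finite_range c.rk).bddAbove
  obtain ⟨s, h1, h2, _⟩ := main (m + 1)
  exact ⟨s, fun R t ht => h2 ⟨R, t, ht⟩ (Nat.lt_succ_of_le (hm ⟨_, rfl⟩)), h1⟩

/-- Existence of (polynomial size) frontiers. -/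
lemma exists_frontier (A : PStruct T ar k) (hA : Function.Injective A.dist) (hg : ∀ g, GS A g)
    (hcore : ∀ h, IsHom A A h → Function.Bijective h) (r : ℕ) (hr : ∀ R, ar R ≤ r) :
    ∃ (J : Type) (_ : Finite J) (F : J → PStruct T ar k), Nat.card J ≤ size A + 1 ∧
      (∀ j, Function.Injective (F j).dist ∧ HomTo (F j) A ∧ ¬ HomTo A (F j) ∧
        size (F j) ≤ (size A + 1) ^ (r + 1)) ∧
      ∀ C, HomTo C A → (∀ j, ¬ HomTo C (F j)) → HomTo A C := by
  classical
  have hpw : size A ≤ (size A + 1) ^ (r + 1) :=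
    (Nat.le_succ _).trans (Nat.le_self_pow (Nat.succ_ne_zero _) _)
  let A0 := restr A (Set.range A.dist) (fun i => ⟨i, rfl⟩)
  have hA0 : IsHom A0 A Subtype.val := restr_isHom _ _ _
  have hA0i : Function.Injective A0.dist := fun i j hij => hA (congrArg Subtype.val hij)
  have hA0s : size A0 ≤ (size A + 1) ^ (r + 1) :=
    (size_le_of_inj hA0 Subtype.val_injective).trans hpw
  have hs0 : ∀ C : PStruct T ar k, (HomTo C A0 → HomTo A A0) → HomTo C A →
      ∃ s0 : A.dom → C.dom, ∀ i, s0 (A.dist i) = C.dist i := by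
    rintro C h ⟨g, hgh⟩
    rcases isEmpty_or_nonempty C.dom with hC | ⟨⟨x0⟩⟩
    · obtain ⟨s, _⟩ := h ⟨fun x => hC.elim x, fun R t ht => by
          have h1 := hgh.1 R t ht
          have h2 : (fun j => g (t j)) =
            fun j => ((hC.elim (t j) : A0.dom)).1 := funext fun j => hC.elim (t j)
          rw [h2] at h1
          exact h1, fun i => hC.elim (C.dist i)⟩
      have hk : ∀ i : Fin k, False := fun i => hC.elim (C.dist i)
      exact ⟨fun a => False.elim (by obtain ⟨i, _⟩ := (s a).2; exact hk i), fun i => (hk i).elim⟩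
    · refine ⟨fun a => if h : ∃ i, A.dist i = a then C.dist h.choose else x0, fun i => ?_⟩
      have h : ∃ i', A.dist i' = A.dist i := ⟨i, rfl⟩
      simp only [dif_pos h]
      rw [hA h.choose_spec]
  rcases isEmpty_or_nonempty (Fact A) with hE | hE
  · refine ⟨{_u : Unit // ¬ HomTo A A0}, inferInstance, fun _ => A0, ?_, ?_, ?_⟩
    · have := Nat.card_le_card_of_injective
        (Subtype.val : {_u : Unit // ¬ HomTo A A0} → Unit) Subtype.val_injective
      rw [show Nat.card Unit = 1 by simp] at this
      omega
    · rintro ⟨_, h⟩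
      exact ⟨hA0i, ⟨_, hA0⟩, h, hA0s⟩
    · intro C hCA hC
      obtain ⟨s0, h0⟩ := hs0 C (fun h => by
        by_contra hn
        exact hC ⟨(), hn⟩ h) hCA
      exact ⟨s0, fun R t ht => hE.elim ⟨R, t, ht⟩, h0⟩
  · obtain ⟨c⟩ := exists_fcert A hg
    have hFF : ∀ f0, c.r f0 = f0 → Function.Injective (FF A (fun f => c.r f = f0)).dist ∧
        HomTo (FF A (fun f => c.r f = f0)) A ∧ ¬ HomTo A (FF A (fun f => c.r f = f0)) ∧
        size (FF A (fun f => c.r f = f0)) ≤ (size A + 1) ^ (r + 1) := by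
      intro f0 h2
      refine ⟨fun i j hij => hA (congrArg Prod.fst hij), FF_homTo _ _,
          FF_not c hcore f0 h2, (FF_size A _ r hr).trans ?_⟩
      rw [pow_succ']
      exact Nat.mul_le_mul_right _ (Nat.le_succ _)
    refine ⟨{o : Option (Fact A) // (o = none → ¬ HomTo A A0) ∧ ∀ f, o = some f → c.r f = f},
      inferInstance, fun o => o.1.elim A0 (fun f0 => FF A (fun f => c.r f = f0)), ?_, ?_, ?_⟩
    · have := Nat.card_le_card_of_injective
        (Subtype.val : {o : Option (Fact A) // (o = none → ¬ HomTo A A0) ∧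
          ∀ f, o = some f → c.r f = f} → Option (Fact A)) Subtype.val_injective
      rw [Finite.card_option] at this
      exact this
    · rintro ⟨_ | f0, h1, h2⟩
      · exact ⟨hA0i, ⟨_, hA0⟩, h1 rfl, hA0s⟩
      · exact hFF f0 (h2 f0 rfl)
    · intro C hCA hC
      obtain ⟨s0, h0⟩ := hs0 C (fun h => by
        by_contra hn
        exact hC ⟨none, fun _ => hn, fun f hf => absurd hf.symm (Option.some_ne_none f)⟩ h) hCA
      refine FF_glue hA (hg 0).1 c C s0 h0 (fun f0 hf0 => ?_)
      refine FF_root hA (hg 0).1 c f0 C hCA (hC ⟨some f0,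
        fun h => absurd h (Option.some_ne_none f0), fun f hf => ?_⟩)
      rw [← Option.some.inj hf, hf0]

end P5

section P6

variable {S T : Type} {arS : S → ℕ} {ar : T → ℕ}

/-- The full structure. -/
def Full (ar : T → ℕ) (m : ℕ) : PStruct T ar m where
  dom := Fin m
  finite := inferInstance
  facts _ := Set.univ
  dist i := i

lemma pat_examples [Finite S] [Finite T] {I : Type} [Finite I] (L : I → LavConstraint S T arS ar)
    (hL : ∀ i g, GS (L i).rhs g) (p : Pat arS) (r s F0 : ℕ) (hr : ∀ R, ar R ≤ r)
    (hs : size (UU L p) ≤ s) (hF0 : size (Full ar p.2.1.1) ≤ F0) :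
    ∃ Ep Em : Set (SMExample S T arS ar), Ep.Finite ∧ Em.Finite ∧
      (∀ e ∈ Ep, Sat e (Set.range L)) ∧ (∀ e ∈ Em, ¬ Sat e (Set.range L)) ∧
      (∀ (I' : Type) [Finite I'] (L' : I' → LavConstraint S T arS ar),
        (∀ e ∈ Ep, Sat e (Set.range L')) → (∀ e ∈ Em, ¬ Sat e (Set.range L')) →
        (Cons L p ↔ Cons L' p) ∧ (Cons L p →
          ∀ D, Function.Injective D.dist → (HomTo (UU L p) D ↔ HomTo (UU L' p) D))) ∧
      Ep.ncard ≤ s + 1 ∧ Em.ncard ≤ s + 1 ∧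
      ∀ e ∈ Ep ∪ Em, size e + 1 ≤ (s + 1) ^ (r + 1) + 2 + F0 := by
  have hpw : s ≤ (s + 1) ^ (r + 1) :=
    (Nat.le_succ _).trans (Nat.le_self_pow (Nat.succ_ne_zero _) _)
  by_cases hc : Cons L p
  · obtain ⟨A, hUA, hA, hAg, hAs, hcore⟩ := exists_core (UU L p)
      (fun _ _ h => Sum.inl.inj h) (fun g => Am_gs _ _ _ _ fun j => hL j.1 g)
    obtain ⟨J, hJ, F, hJc, hF, hfr⟩ := exists_frontier A hA hAg hcore r hr
    have hJ' : (Set.range fun j => mkE p (F j)).ncard ≤ Nat.card J := by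
      have := Set.ncard_image_le (f := fun j => mkE p (F j)) (Set.finite_univ (α := J))
      rwa [Set.image_univ, Set.ncard_univ] at this
    refine ⟨{mkE p A}, Set.range fun j => mkE p (F j), Set.finite_singleton _,
      Set.finite_range _, ?_, ?_, ?_, ?_, ?_, ?_⟩
    · rintro e rfl
      exact (sat_mkE L p A hA).2 ⟨hc, hUA.1⟩
    · rintro e ⟨j, rfl⟩ h
      exact (hF j).2.2.1 (hUA.2.trans ((sat_mkE L p (F j) (hF j).1).1 h).2)
    · intro I' _ L' h1 h2
      have h3 := (sat_mkE L' p A hA).1 (h1 _ rfl)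
      refine ⟨⟨fun _ => h3.1, fun _ => hc⟩, fun _ => ?_⟩
      have h4 : HomTo A (UU L' p) := hfr _ h3.2 fun j hj =>
        h2 _ ⟨j, rfl⟩ ((sat_mkE L' p (F j) (hF j).1).2 ⟨h3.1, hj⟩)
      exact fun D _ => ⟨fun h => h3.2.trans (hUA.2.trans h), fun h => hUA.1.trans (h4.trans h)⟩
    · rw [Set.ncard_singleton]; omega
    · omega
    · rintro e (rfl | ⟨j, rfl⟩)
      · have := size_mkE p A
        omega
      · have := size_mkE p (F j)
        have h2 := (hF j).2.2.2
        have h3 : (size A + 1) ^ (r + 1) ≤ (s + 1) ^ (r + 1) := Nat.pow_le_pow_left (by omega) _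
        show size (mkE p (F j)) + 1 ≤ _
        omega
  · have hi : Function.Injective (Full ar p.2.1.1).dist := fun _ _ h => h
    refine ⟨∅, {mkE p (Full ar p.2.1.1)}, Set.finite_empty, Set.finite_singleton _,
      fun e h => h.elim, ?_, ?_, ?_, ?_, ?_⟩
    · rintro e rfl h
      exact hc ((sat_mkE L p _ hi).1 h).1
    · intro I' _ L' _ h2
      refine ⟨⟨fun h => (hc h).elim, fun h => ?_⟩, fun h => (hc h).elim⟩
      exfalso
      unfold Cons at hc
      push Not at hc
      obtain ⟨j, a, -⟩ := hc
      refine h2 _ rfl ((sat_mkE L' p _ hi).2 ⟨h, Sum.elim (fun x => x) (fun _ => agm L p j a),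
        fun _ _ _ => Set.mem_univ _, fun _ => rfl⟩)
    · simp
    · rw [Set.ncard_singleton]; omega
    · rintro e (h | rfl)
      · exact h.elim
      · have := size_mkE p (Full ar p.2.1.1)
        omega

lemma totalSize_le {k : ℕ} (F : Set (PStruct T ar k)) (hF : F.Finite) (a b : ℕ)
    (ha : F.ncard ≤ a) (hb : ∀ e ∈ F, size e + 1 ≤ b) : totalSize F ≤ a * b := by
  unfold totalSize
  rw [finsum_mem_eq_finite_toFinset_sum _ hF]
  refine (Finset.sum_le_card_nsmul _ _ b fun e he => hb e (hF.mem_toFinset.1 he)).trans ?_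
  rw [← Set.ncard_eq_toFinset_card F hF, smul_eq_mul]
  exact Nat.mul_le_mul_right _ ha

lemma exists_enum {X : Type 1} (M : Set X) (hM : M.Finite) :
    ∃ (n : ℕ) (L : Fin n → X), Function.Injective L ∧ Set.range L = M := by
  have := hM.to_subtype
  obtain ⟨n, ⟨e⟩⟩ := Finite.exists_equiv_fin M
  refine ⟨n, fun i => (e.symm i).1, fun i j h => e.symm.injective (Subtype.ext h), ?_⟩
  ext x
  constructor
  · rintro ⟨i, rfl⟩
    exact (e.symm i).2
  · intro hx
    exact ⟨e ⟨x, hx⟩, by simp⟩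

lemma ncard_iUnion_le' {P : Type} [Finite P] {X : Type 1} (E : P → Set X) (a : ℕ)
    (hE : ∀ p, (E p).Finite) (ha : ∀ p, (E p).ncard ≤ a) :
    (⋃ p, E p).ncard ≤ Nat.card P * a := by
  classical
  have := Fintype.ofFinite P
  have h : (⋃ p, E p) = ↑(Finset.univ.biUnion fun p => (hE p).toFinset) := by
    ext x; simp
  rw [h, Set.ncard_coe_finset, Nat.card_eq_fintype_card]
  refine Finset.card_biUnion_le_card_mul _ _ _ fun p _ => ?_
  rw [← Set.ncard_eq_toFinset_card (E p) (hE p)]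
  exact ha p

theorem part2 (S T : Type) [Finite S] [Finite T] (arS : S → ℕ) (arT : T → ℕ) :
    ∃ p : Polynomial ℕ, ∀ M : Set (LavConstraint S T arS arT), M.Finite → CAcyclicMap M →
      ∃ Ep Em : Set (SMExample S T arS arT), Ep.Finite ∧ Em.Finite ∧
        UniqCharMap Ep Em M ∧
        totalSize Ep + totalSize Em ≤ p.eval (mapSize M) := by
  classical
  obtain ⟨r, hr⟩ := exists_arity_bound arT
  have := Fintype.ofFinite (Pat arS)
  obtain ⟨F0, hF0⟩ : ∃ F0, ∀ p : Pat arS, size (Full arT p.2.1.1) ≤ F0 :=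
    ⟨∑ p : Pat arS, size (Full arT p.2.1.1), fun p =>
      Finset.single_le_sum (f := fun p : Pat arS => size (Full arT p.2.1.1))
        (fun _ _ => Nat.zero_le _) (Finset.mem_univ p)⟩
  refine ⟨2 * (Polynomial.C (Nat.card (Pat arS)) * (Polynomial.X + 1) *
    ((Polynomial.X + 1) ^ (r + 1) + 2 + Polynomial.C F0)), ?_⟩
  intro M hM hMc
  obtain ⟨n, L, hLi, rfl⟩ := exists_enum M hM
  have hs : ∀ p, size (UU L p) ≤ mapSize (Set.range L) := by
    intro p
    have h1 : mapSize (Set.range L) = ∑ i, (size (L i).rhs + (L i).m + 1) := by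
      unfold mapSize
      rw [finsum_mem_range hLi, finsum_eq_sum_of_fintype]
    refine (Am_size _ _ _ _).trans ?_
    rw [h1]
    refine le_trans ?_ (Finset.sum_le_sum (f := fun i => size (L i).rhs) fun i _ => by omega)
    have e1 := Finset.sum_map (Finset.univ : Finset (App L p)) (Function.Embedding.subtype _)
      (fun i => size (L i).rhs)
    refine e1.symm.le.trans (Finset.sum_le_sum_of_subset (Finset.subset_univ _))
  choose Ep Em h1 h2 h3 h4 h5 h6 h7 h8 using fun p =>
    pat_examples L (fun i g => (hMc _ ⟨i, rfl⟩).gs g) p r _ F0 hr (hs p) (hF0 p)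
  refine ⟨⋃ p, Ep p, ⋃ p, Em p, Set.finite_iUnion h1, Set.finite_iUnion h2, ⟨?_, ?_, ?_⟩, ?_⟩
  · intro e he
    obtain ⟨p, hp⟩ := Set.mem_iUnion.1 he
    exact h3 p e hp
  · intro e he
    obtain ⟨p, hp⟩ := Set.mem_iUnion.1 he
    exact h4 p e hp
  · intro M' hM' h9 h10
    obtain ⟨n', L', -, rfl⟩ := exists_enum M' hM'
    exact logEquiv_of L L' fun p => h5 p _ L' (fun e he => h9 e (Set.mem_iUnion.2 ⟨p, he⟩))
      (fun e he => h10 e (Set.mem_iUnion.2 ⟨p, he⟩))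
  · have e1 := totalSize_le _ (Set.finite_iUnion h1) _ _ (ncard_iUnion_le' Ep _ h1 h6)
      (fun e he => by
        obtain ⟨p, hp⟩ := Set.mem_iUnion.1 he
        exact h8 p e (Or.inl hp))
    have e2 := totalSize_le _ (Set.finite_iUnion h2) _ _ (ncard_iUnion_le' Em _ h2 h7)
      (fun e he => by
        obtain ⟨p, hp⟩ := Set.mem_iUnion.1 he
        exact h8 p e (Or.inr hp))
    simp only [Polynomial.eval_mul, Polynomial.eval_add, Polynomial.eval_pow, Polynomial.eval_C,
      Polynomial.eval_X, Polynomial.eval_one, Polynomial.eval_ofNat]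
    omega

end P6

section P7

variable {S T : Type} {arS : S → ℕ} {ar : T → ℕ}

lemma sat_key {I : Type} [Finite I] (L : I → LavConstraint S T arS ar) (p : Pat arS)
    (e : SMExample S T arS ar) (he : Sat e (Set.range L)) (g : Fin p.2.1.1 → e.dom)
    (ht : (fun i => g (p.2.2.1 i)) ∈ e.facts (Sum.inl p.1)) :
    ∀ j : App L p, HomTo (L j.1).rhs (reD (tg e g) (agm L p j)) := by
  intro j
  have hs := j.2.choose_spec
  have hr := he (L j.1) ⟨_, rfl⟩
  have : ∀ (R : S) (q : Fin (arS R) → Fin p.2.1.1), (fun i => g (q i)) ∈ e.facts (Sum.inl R) →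
      (⟨(L j.1).rel, fun x => agm L p j ((L j.1).pat x)⟩ : Σ R : S, Fin (arS R) → Fin p.2.1.1)
        = ⟨R, q⟩ → HomTo (L j.1).rhs (reD (tg e g) (agm L p j)) := by
    intro R q hq heq
    obtain ⟨rfl, h2⟩ := Sigma.mk.inj heq
    have h2 := eq_of_heq h2
    subst h2
    exact hr _ hq (fun x => g (agm L p j x)) (fun i => rfl)
  exact this _ _ ht hs

/-- The homomorphic image structure. -/
def imgS {k : ℕ} (A B : PStruct T ar k) (h : A.dom → B.dom) : PStruct T ar k :=
  ofFam B.dom (fun f : Fact A => ⟨f.1, fun i => h (f.2.1 i)⟩) B.dist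

/-- Discrete structure identifying `a` and `b`. -/
def discS (ar : T → ℕ) {m : ℕ} (a b : Fin m) : PStruct T ar m where
  dom := Fin m
  finite := inferInstance
  facts _ := ∅
  dist x := if x = a then b else x

lemma discS_gs {m : ℕ} (a b : Fin m) (g : ℕ) : GS (discS ar a b) g := by
  refine ⟨?_, ?_⟩
  · intro f
    exact f.2.2.elim
  · intro Y hY
    obtain ⟨f, _⟩ := hY
    exact f.2.2.elim

lemma discS_eq {m : ℕ} (a b : Fin m) : (discS ar a b).dist a = (discS ar a b).dist b := by
  refine (if_pos rfl : (if a = a then b else a) = b).trans ?_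
  exact (ite_self b : (if b = a then b else b) = b).symm

lemma exists_V [Finite S] [Finite T] {I : Type} [Finite I] (L Ln : I → LavConstraint S T arS ar)
    (hLL : LogEquiv (Set.range L) (Set.range Ln)) (g : ℕ) (p : Pat arS) (hgp : size (UU L p) ≤ g)
    (hLn : ∀ i, GS (Ln i).rhs g) :
    ∃ V : PStruct T ar p.2.1.1, (∀ g, GS V g) ∧
      (∀ e : SMExample S T arS ar, Sat e (Set.range L) → ∀ g : Fin p.2.1.1 → e.dom,
        (fun i => g (p.2.2.1 i)) ∈ e.facts (Sum.inl p.1) → HomTo V (tg e g)) ∧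
      ∀ D, Function.Injective D.dist → HomTo V D → Cons L p ∧ HomTo (UU L p) D := by
  by_cases hc : Cons L p
  · have hn := (sat_mkE Ln p (UU L p) (fun _ _ h => Sum.inl.inj h)).1 ((hLL _).1
      ((sat_mkE L p (UU L p) (fun _ _ h => Sum.inl.inj h)).2 ⟨hc, HomTo.refl _⟩))
    obtain ⟨-, h, hh⟩ := (sat_mkE L p (UU Ln p) (fun _ _ h => Sum.inl.inj h)).1 ((hLL _).2
      ((sat_mkE Ln p (UU Ln p) (fun _ _ h => Sum.inl.inj h)).2 ⟨hn.1, HomTo.refl _⟩))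
    have h1 : IsHom (imgS (UU L p) (UU Ln p) h) (UU Ln p) (fun x => x) := by
      refine ⟨?_, fun _ => rfl⟩
      rintro R t ⟨f, hf⟩
      obtain ⟨R', t', ht'⟩ := f
      obtain ⟨rfl, h1⟩ := Sigma.mk.inj hf
      rw [← eq_of_heq h1]
      exact hh.1 _ _ ht'
    have h2 : HomTo (UU L p) (imgS (UU L p) (UU Ln p) h) :=
      ⟨h, fun R t ht => ⟨⟨R, t, ht⟩, rfl⟩, hh.2⟩
    refine ⟨imgS (UU L p) (UU Ln p) h, ?_, ?_, ?_⟩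
    · have hg : GS (UU Ln p) g := Am_gs _ _ _ _ fun j => hLn j.1
      refine (GS.sub (A := imgS (UU L p) (UU Ln p) h) hg (fun x => x) h1
        (fun _ _ h => h)).all ?_
      exact (ofFam_size_le _ _ _).trans hgp
    · intro e he g ht
      exact HomTo.trans ⟨_, h1⟩
        ((Am_hom _ _ _ _ hn.1 _).2 (sat_key Ln p e ((hLL _).1 he) g ht))
    · intro D _ hV
      exact ⟨hc, h2.trans hV⟩
  · have hc' := hc
    unfold Cons at hc'
    push Not at hc'
    obtain ⟨j, x, y, hxy, hne⟩ := hc'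
    refine ⟨discS ar (agm L p j x) (agm L p j y), discS_gs _ _, ?_, ?_⟩
    · intro e he g ht
      obtain ⟨h, hh⟩ := sat_key L p e he g ht j
      have e1 : g (agm L p j x) = g (agm L p j y) :=
        (hh.2 x).symm.trans ((congrArg h hxy).trans (hh.2 y))
      refine ⟨g, fun R t ht => ht.elim, fun i => ?_⟩
      change g (if i = agm L p j x then agm L p j y else i) = g i
      split_ifs with hi
      · rw [hi, e1]
      · rfl
    · rintro D hD ⟨h, hh⟩
      exfalso
      apply hne
      apply hD
      have e1 := hh.2 (agm L p j x)
      have e2 := hh.2 (agm L p j y)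
      have e3 := discS_eq (ar := ar) (agm L p j x) (agm L p j y)
      exact e1.symm.trans ((congrArg h e3).trans e2)

lemma part1_fwd [Finite S] [Finite T] (M : Set (LavConstraint S T arS ar)) (hM : M.Finite)
    (Ep Em : Set (SMExample S T arS ar)) (hEp : Ep.Finite) (hEm : Em.Finite)
    (hU : UniqCharMap Ep Em M) :
    ∃ M' : Set (LavConstraint S T arS ar), M'.Finite ∧ CAcyclicMap M' ∧ LogEquiv M M' := by
  obtain ⟨N, L, -, rfl⟩ := exists_enum M hM
  obtain ⟨n, hn⟩ := ((hEp.union hEm).image fun e => Nat.card e.dom).bddAbove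
  obtain ⟨g, hg⟩ := (Set.finite_range fun p : Pat arS => size (UU L p)).bddAbove
  choose C hCA hCg hCn using fun i => sparse_struct (L i).rhs n g
  let Ln : Fin N → LavConstraint S T arS ar :=
    fun i => ⟨(L i).m, (L i).rel, (L i).pat, (L i).surj, C i⟩
  have heq : ∀ e ∈ Ep ∪ Em, (Sat e (Set.range L) ↔ Sat e (Set.range Ln)) := by
    intro e he
    have hcard : Nat.card e.dom ≤ n := hn ⟨e, he, rfl⟩
    constructor
    · rintro h _ ⟨i, rfl⟩ t ht g hg
      exact HomTo.trans (C := tg e g) (hCA i) (h _ ⟨i, rfl⟩ t ht g hg)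
    · rintro h _ ⟨i, rfl⟩ t ht g hg
      exact hCn i (tg e g) hcard (h _ ⟨i, rfl⟩ t ht g hg)
  have hLL : LogEquiv (Set.range L) (Set.range Ln) := hU.2.2 _ (Set.finite_range _)
    (fun e he => (heq e (Or.inl he)).1 (hU.1 e he))
    (fun e he h => hU.2.1 e he ((heq e (Or.inr he)).2 h))
  choose V hVg hV1 hV2 using fun p : Pat arS => exists_V L Ln hLL g p (hg ⟨p, rfl⟩) hCg
  refine ⟨Set.range fun p : Pat arS => ⟨p.2.1.1, p.1, p.2.2.1, p.2.2.2, V p⟩,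
    Set.finite_range _, ?_, ?_⟩
  · rintro _ ⟨p, rfl⟩
    exact cacyclic_of_gs (hVg p)
  · intro e
    constructor
    · rintro h _ ⟨p, rfl⟩ t ht g hg
      have : t = fun i => g (p.2.2.1 i) := funext hg
      exact hV1 p e h g (this ▸ ht)
    · intro h
      apply sat_of_local
      intro R t ht
      obtain ⟨m, q, g, hq, hg, htq⟩ := exists_pat t
      have := h _ ⟨⟨R, m, q, hq⟩, rfl⟩ t ht g htq
      exact ⟨m, q, g, hq, hg, htq, hV2 ⟨R, m, q, hq⟩ (tg e g) hg this⟩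

end P7

/-- A LAV schema mapping is uniquely characterizable by finitely many positive and
negative schema-mapping examples iff it is logically equivalent to a c-acyclic LAV
schema mapping; moreover, for c-acyclic LAV schema mappings such examples can be
constructed in polynomial time (in particular, of total size bounded by a fixed
polynomial). -/
theorem stmt_19 (S T : Type) [Finite S] [Finite T] (arS : S → ℕ) (arT : T → ℕ) :
    (∀ M : Set (LavConstraint S T arS arT), M.Finite →
      ((∃ Ep Em : Set (SMExample S T arS arT), Ep.Finite ∧ Em.Finite ∧
          UniqCharMap Ep Em M) ↔
        (∃ M' : Set (LavConstraint S T arS arT), M'.Finite ∧ CAcyclicMap M' ∧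
          LogEquiv M M'))) ∧
    ∃ p : Polynomial ℕ, ∀ M : Set (LavConstraint S T arS arT), M.Finite → CAcyclicMap M →
      ∃ Ep Em : Set (SMExample S T arS arT), Ep.Finite ∧ Em.Finite ∧
        UniqCharMap Ep Em M ∧
        totalSize Ep + totalSize Em ≤ p.eval (mapSize M) := by
  obtain ⟨p, hp⟩ := part2 S T arS arT
  refine ⟨fun M hM => ⟨?_, ?_⟩, p, hp⟩
  · rintro ⟨Ep, Em, h1, h2, h3⟩
    exact part1_fwd M hM Ep Em h1 h2 h3
  · rintro ⟨M', hM', hc, hMM⟩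
    obtain ⟨Ep, Em, h1, h2, h3, -⟩ := hp M' hM' hc
    refine ⟨Ep, Em, h1, h2, fun e he => (hMM e).2 (h3.1 e he),
      fun e he h => h3.2.1 e he ((hMM e).1 h), fun M'' h4 h5 h6 e => ?_⟩
    exact (hMM e).trans (h3.2.2 M'' h4 h5 h6 e)
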